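/- arXiv:2004.12561 — 3 statements merged into one kernel-verified Lean document; each statement's English description precedes it below -/
import Mathlib

section
/- Let k ≥ 3 be an integer and ζ > 0 a real number. There exists n₁ = n₁(k,ζ) such that for every integer n ≥ n₁ the following holds. Let H be a (1,k)-partite (k+1)-graph with partition classes {x_1, …, x_{⌊n/k⌋}}, [n] such that d_H(x_i) > C(n,k) − C(n−t+1,k) for i ∈ [t] and d_H(x_i) = C(n,k) for t < i ≤ ⌊n/k⌋, where t is an integer with n/(3k²) ≤ t ≤ (1−ζ)n/k. Then for any real c with 0 < c < ζ^{2k}·(12k²·2^k·(k!)^k)^{-2} there exists a matching M in H with |M| ≤ 2kcn such that for every balanced subset S ⊆ V(H) ∖ V(M) with |S| ≤ (k+1)·c^{1.5}·n/2, the induced subhypergraph H[V(M) ∪ S] has a perfect matching. -/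
open Finset

/-- `H` contains a matching whose vertex set has left part `X` and right part `A`, with at most
one edge per element of `X`. -/
def HasMatchingOn {ι α : Type*} [DecidableEq ι] [DecidableEq α] (H : Finset (Finset (ι ⊕ α)))
    (X : Finset ι) (A : Finset α) : Prop :=
  ∃ P ⊆ H, (∀ e ∈ P, ∀ f ∈ P, e ≠ f → Disjoint e f) ∧ P.card ≤ X.card ∧
    P.biUnion id = X.disjSum A

section Absorption

variable {ι α : Type*} [DecidableEq ι] [DecidableEq α] {H : Finset (Finset (ι ⊕ α))}

lemma HasMatchingOn.empty : HasMatchingOn H ∅ ∅ :=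
  ⟨∅, by simp, by simp, by simp, by simp⟩

lemma HasMatchingOn.insert_edge {X : Finset ι} {A U : Finset α} {x : ι}
    (h : HasMatchingOn H X A) (hx : x ∉ X) (hU : Disjoint U A)
    (he : ({x} : Finset ι).disjSum U ∈ H) : HasMatchingOn H (insert x X) (U ∪ A) := by
  obtain ⟨P, hPH, hP, hcard, hcov⟩ := h
  have hdisj : ∀ e ∈ P, Disjoint (({x} : Finset ι).disjSum U) e := by
    intro e heP
    have hsub : e ⊆ X.disjSum A := hcov ▸ Finset.subset_biUnion_of_mem id heP
    refine Disjoint.mono_right hsub ?_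
    rw [Finset.disjoint_left]
    rintro (a | a) ha hb
    · simp only [inl_mem_disjSum, mem_singleton] at ha hb
      exact hx (ha ▸ hb)
    · simp only [inr_mem_disjSum] at ha hb
      exact Finset.disjoint_left.1 hU ha hb
  refine ⟨insert (({x} : Finset ι).disjSum U) P, ?_, ?_, ?_, ?_⟩
  · exact Finset.insert_subset he hPH
  · intro e he f hf hef
    rw [Finset.mem_insert] at he hf
    rcases he with rfl | he <;> rcases hf with rfl | hf
    · exact absurd rfl hef
    · exact hdisj _ hf
    · exact (hdisj _ he).symm
    · exact hP _ he _ hf hef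
  · rw [Finset.card_insert_of_notMem hx]
    exact (Finset.card_insert_le _ _).trans (by omega)
  · rw [Finset.biUnion_insert, hcov]
    ext (a | a) <;> simp

/-- Pairwise disjoint `k`-sets matched injectively to complete left vertices form a matching. -/
lemma hasMatchingOn_image {k : ℕ} {y : Finset α → ι} (F : Finset (Finset α))
    (hF : (F : Set (Finset α)).PairwiseDisjoint id) (hFk : ∀ U ∈ F, U.card = k)
    (hy : Set.InjOn y F)
    (hcomplete : ∀ U ∈ F, ∀ V : Finset α, V.card = k → ({y U} : Finset ι).disjSum V ∈ H) :
    HasMatchingOn H (F.image y) (F.biUnion id) := by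
  induction F using Finset.induction_on with
  | empty => simpa using HasMatchingOn.empty
  | insert U F hU ih =>
    have ih' := ih (hF.subset (by simp)) (fun V hV => hFk V (by simp [hV]))
      (hy.mono (by simp)) (fun V hV => hcomplete V (by simp [hV]))
    rw [Finset.image_insert, Finset.biUnion_insert]
    refine ih'.insert_edge ?_ ?_ (hcomplete U (by simp) U (hFk U (by simp)))
    · intro hmem
      obtain ⟨V, hV, hVU⟩ := Finset.mem_image.1 hmem
      exact hU (hy (by simp [hV]) (by simp) hVU ▸ hV)
    · rw [Finset.disjoint_biUnion_right]
      intro V hV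
      exact hF (by simp) (by simp [hV]) (fun h => hU (h ▸ hV))

/-- A balanced set with left part `L` and right part `R` is absorbed by the matching that pairs each
`U ∈ F` with the complete vertex `y U`, as long as every `x ∈ L` has `|L|` neighbours in `F`. -/
lemma hasMatchingOn_absorb {k : ℕ} {y : Finset α → ι} (L : Finset ι) :
    ∀ (R : Finset α) (F : Finset (Finset α)),
    (F : Set (Finset α)).PairwiseDisjoint id → (∀ U ∈ F, U.card = k) → Set.InjOn y F →
    (∀ U ∈ F, ∀ V : Finset α, V.card = k → ({y U} : Finset ι).disjSum V ∈ H) →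
    Disjoint L (F.image y) → Disjoint R (F.biUnion id) → R.card = k * L.card →
    (∀ x ∈ L, L.card ≤ (F.filter fun U => ({x} : Finset ι).disjSum U ∈ H).card) →
    HasMatchingOn H (F.image y ∪ L) (F.biUnion id ∪ R) := by
  induction L using Finset.induction_on with
  | empty =>
    intro R F hF hFk hy hcomplete _ _ hR _
    have : R = ∅ := by simpa using hR
    subst this
    simpa using hasMatchingOn_image F hF hFk hy hcomplete
  | insert x L hx ih =>
    intro R F hF hFk hy hcomplete hLF hRF hR hdeg
    rw [Finset.card_insert_of_notMem hx] at hR hdeg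
    obtain ⟨U, hU⟩ : (F.filter fun U => ({x} : Finset ι).disjSum U ∈ H).Nonempty := by
      rw [← Finset.card_pos]
      have := hdeg x (by simp)
      omega
    rw [Finset.mem_filter] at hU
    obtain ⟨hUF, hUx⟩ := hU
    obtain ⟨V, hVR, hVk⟩ : ∃ V ⊆ R, V.card = k :=
      Finset.exists_subset_card_eq (by rw [hR]; nlinarith)
    have hsub : F.erase U ⊆ F := Finset.erase_subset _ _
    have hunion : F.biUnion id = U ∪ (F.erase U).biUnion id := by
      conv_lhs => rw [← Finset.insert_erase hUF, Finset.biUnion_insert]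
      rfl
    have himage : F.image y = insert (y U) ((F.erase U).image y) := by
      conv_lhs => rw [← Finset.insert_erase hUF, Finset.image_insert]
    have hyU : y U ∉ (F.erase U).image y := by
      intro hmem
      obtain ⟨W, hW, hWU⟩ := Finset.mem_image.1 hmem
      exact (Finset.mem_erase.1 hW).1 (hy (hsub hW) hUF hWU)
    have hUdisj : Disjoint U ((F.erase U).biUnion id) := by
      rw [Finset.disjoint_biUnion_right]
      intro W hW
      exact hF hUF (hsub hW) (Finset.mem_erase.1 hW).1.symm
    rw [hunion, Finset.disjoint_union_right] at hRF
    rw [himage, Finset.disjoint_insert_left, Finset.disjoint_insert_right] at hLF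
    have hmatch := ih (R \ V) (F.erase U) (hF.subset (by exact_mod_cast hsub))
      (fun W hW => hFk W (hsub hW)) (hy.mono (by exact_mod_cast hsub))
      (fun W hW => hcomplete W (hsub hW)) hLF.2.2
      (hRF.2.mono_left Finset.sdiff_subset)
      (by rw [Finset.card_sdiff_of_subset hVR, hR, hVk, Nat.mul_succ]; omega)
      (fun z hz => by
        have h₁ := hdeg z (by simp [hz])
        have h₂ := Finset.pred_card_le_card_erase
          (s := F.filter fun U => ({z} : Finset ι).disjSum U ∈ H) (a := U)
        rw [Finset.filter_erase]
        omega)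
    have hmatch₁ := hmatch.insert_edge (x := y U) (U := V)
      (by
        rw [Finset.mem_union, not_or]
        exact ⟨hyU, hLF.2.1⟩)
      (by
        rw [Finset.disjoint_union_right]
        exact ⟨hRF.2.mono_left hVR, Finset.disjoint_sdiff⟩)
      (hcomplete U hUF V hVk)
    have hmatch₂ := hmatch₁.insert_edge (x := x) (U := U)
      (by
        simp only [Finset.mem_insert, Finset.mem_union, not_or] at hLF ⊢
        exact ⟨hLF.1.1, hLF.1.2, hx⟩)
      (by
        rw [Finset.disjoint_union_right, Finset.disjoint_union_right]
        exact ⟨(hRF.1.mono_left hVR).symm, hUdisj,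
          (hRF.1.mono_left Finset.sdiff_subset).symm⟩)
      hUx
    convert hmatch₂ using 1
    · rw [himage]
      ext a
      simp only [Finset.mem_union, Finset.mem_insert]
      tauto
    · rw [hunion, show V ∪ ((F.erase U).biUnion id ∪ R \ V) = (F.erase U).biUnion id ∪ R by
        rw [Finset.union_left_comm, Finset.union_sdiff_of_subset hVR], Finset.union_assoc]

end Absorption

section Selection

/-- Derandomised selection: if each `k`-graph `N i` keeps density `d` after deleting any `k * q`
vertices, then there are `q` disjoint `k`-sets such that every `N i` contains many of them,
measured by the exponential potential `∑ i, 2⁻¹ ^ |F ∩ N i|`. -/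
lemma exists_pairwiseDisjoint_potential_le {ι α : Type*} [Fintype ι] [Nonempty ι] [Fintype α]
    [DecidableEq α] {k q : ℕ} (hk : 0 < k) (hkα : k ≤ Fintype.card α)
    (N : ι → Finset (Finset α)) {d : ℝ} (hd : 0 < d)
    (hN : ∀ i, ∀ W : Finset α, W.card ≤ k * q →
      d * (Fintype.card α).choose k ≤ ((powersetCard k Wᶜ).filter (· ∈ N i)).card) :
    ∀ j ≤ q, ∃ F : Finset (Finset α), F.card = j ∧ (∀ U ∈ F, U.card = k) ∧
      (F : Set (Finset α)).PairwiseDisjoint id ∧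
      ∑ i, (2⁻¹ : ℝ) ^ (F.filter (· ∈ N i)).card ≤ Fintype.card ι * (1 - d / 2) ^ j := by
  intro j
  induction j with
  | zero =>
    intro _
    exact ⟨∅, by simp, by simp, by simp, by simp⟩
  | succ j ih =>
    intro hj
    obtain ⟨F, hFj, hFk, hF, hpot⟩ := ih (by omega)
    set W := F.biUnion id with hW
    have hWcard : W.card ≤ k * q := by
      calc W.card ≤ F.card * k := Finset.card_biUnion_le_card_mul _ _ _ fun U hU => (hFk U hU).le
        _ ≤ k * q := by rw [hFj, mul_comm]; exact Nat.mul_le_mul_left _ (by omega)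
    set A := powersetCard k Wᶜ with hA
    have hchoose : 0 < ((Fintype.card α).choose k : ℝ) := by
      exact_mod_cast Nat.choose_pos hkα
    have hAne : A.Nonempty := by
      obtain ⟨i⟩ := ‹Nonempty ι›
      have h := (mul_pos hd hchoose).trans_le (hN i W hWcard)
      have h' : 0 < (A.filter (· ∈ N i)).card := by exact_mod_cast h
      exact (Finset.card_pos.1 h').mono (Finset.filter_subset _ _)
    have hAcard : (A.card : ℝ) ≤ (Fintype.card α).choose k := by
      rw [hA, Finset.card_powersetCard]
      exact_mod_cast Nat.choose_le_choose k (Finset.card_le_univ _)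
    have hnotMem : ∀ U ∈ A, U ∉ F := by
      intro U hU hUF
      rw [hA, Finset.mem_powersetCard] at hU
      obtain ⟨a, ha⟩ : U.Nonempty := Finset.card_pos.1 (by omega)
      have := hU.1 ha
      rw [Finset.mem_compl] at this
      exact this (Finset.mem_biUnion.2 ⟨U, hUF, ha⟩)
    set φ : ι → ℝ := fun i => (2⁻¹ : ℝ) ^ (F.filter (· ∈ N i)).card with hφ
    have hstep : ∀ U ∈ A, ∀ i, (2⁻¹ : ℝ) ^ ((insert U F).filter (· ∈ N i)).card =
        φ i * (1 - if U ∈ N i then 2⁻¹ else 0) := by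
      intro U hU i
      rw [Finset.filter_insert]
      split_ifs with h
      · rw [Finset.card_insert_of_notMem (by simp [hnotMem U hU]), pow_succ, hφ]
        norm_num
      · simp [hφ]
    have hsum : ∑ U ∈ A, ∑ i, (2⁻¹ : ℝ) ^ ((insert U F).filter (· ∈ N i)).card ≤
        ∑ _U ∈ A, (Fintype.card ι * (1 - d / 2) ^ (j + 1) : ℝ) := by
      rw [Finset.sum_congr rfl fun U hU => Finset.sum_congr rfl fun i _ => hstep U hU i,
        Finset.sum_comm]
      have hi : ∀ i, ∑ U ∈ A, φ i * (1 - if U ∈ N i then (2⁻¹ : ℝ) else 0) ≤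
          φ i * (A.card * (1 - d / 2)) := by
        intro i
        rw [← Finset.mul_sum]
        refine mul_le_mul_of_nonneg_left ?_ (by positivity)
        rw [Finset.sum_sub_distrib, ← Finset.sum_filter]
        simp only [Finset.sum_const, nsmul_eq_mul, mul_one]
        have h := hN i W hWcard
        nlinarith
      have hd1 : 0 ≤ 1 - d / 2 := by
        obtain ⟨i⟩ := ‹Nonempty ι›
        have h := hN i W hWcard
        have h₁ : ((A.filter (· ∈ N i)).card : ℝ) ≤ A.card := by
          exact_mod_cast Finset.card_filter_le _ _
        have h₂ : d * (Fintype.card α).choose k ≤ 1 * (Fintype.card α).choose k := by linarith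
        have := le_of_mul_le_mul_right h₂ hchoose
        linarith
      calc _ ≤ ∑ i, φ i * (A.card * (1 - d / 2)) := Finset.sum_le_sum fun i _ => hi i
        _ = (∑ i, φ i) * (A.card * (1 - d / 2)) := by rw [Finset.sum_mul]
        _ ≤ (Fintype.card ι * (1 - d / 2) ^ j) * (A.card * (1 - d / 2)) :=
          mul_le_mul_of_nonneg_right hpot (by positivity)
        _ = _ := by rw [Finset.sum_const, nsmul_eq_mul]; ring
    obtain ⟨U, hU, hUle⟩ := Finset.exists_le_of_sum_le hAne hsum
    have hUA := hU
    rw [hA, Finset.mem_powersetCard] at hUA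
    refine ⟨insert U F, ?_, ?_, ?_, hUle⟩
    · rw [Finset.card_insert_of_notMem (hnotMem U hU), hFj]
    · intro V hV
      rcases Finset.mem_insert.1 hV with rfl | hV
      · exact hUA.2
      · exact hFk V hV
    · rw [Finset.coe_insert]
      refine hF.insert fun V hV _ => ?_
      refine Disjoint.mono_right (Finset.subset_biUnion_of_mem id hV) ?_
      exact Finset.disjoint_left.2 fun a ha => Finset.mem_compl.1 (hUA.1 ha)

lemma mul_choose_sub_le (n s k : ℕ) (hs : s ≤ n) :
    n * (n - s).choose (k + 1) ≤ (n - s) * n.choose (k + 1) := by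
  rcases Nat.eq_zero_or_pos (n - s) with h | h
  · simp [h]
  obtain ⟨m, hm⟩ : ∃ m, n - s = m + 1 := ⟨n - s - 1, by omega⟩
  obtain ⟨p, hp⟩ : ∃ p, n = p + 1 := ⟨n - 1, by omega⟩
  rw [hm, hp]
  have h₁ := Nat.add_one_mul_choose_eq m k
  have h₂ := Nat.add_one_mul_choose_eq p k
  have h₃ : m.choose k ≤ p.choose k := Nat.choose_le_choose k (by omega)
  refine Nat.le_of_mul_le_mul_right (c := k + 1) ?_ (by omega)
  calc (p + 1) * (m + 1).choose (k + 1) * (k + 1) = (p + 1) * ((m + 1) * m.choose k) := by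
        rw [h₁]; ring
    _ ≤ (p + 1) * ((m + 1) * p.choose k) := by gcongr
    _ = (m + 1) * ((p + 1) * p.choose k) := by ring
    _ = _ := by rw [h₂]; ring

lemma choose_le_choose_sub_add (n w k : ℕ) :
    n.choose (k + 1) ≤ (n - w).choose (k + 1) + w * (n - 1).choose k := by
  induction w with
  | zero => simp
  | succ w ih =>
    rcases Nat.eq_zero_or_pos (n - w) with h | h
    · rw [h] at ih
      rw [show n - (w + 1) = 0 by omega]
      nlinarith
    · obtain ⟨m, hm⟩ : ∃ m, n - w = m + 1 := ⟨n - w - 1, by omega⟩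
      rw [hm, Nat.choose_succ_succ] at ih
      have h₃ : m.choose k ≤ (n - 1).choose k := Nat.choose_le_choose k (by omega)
      rw [show n - (w + 1) = m by omega]
      nlinarith

/-- Deleting `w` vertices destroys at most a `k * w / n` fraction of all `k`-sets. -/
lemma card_sub_le_card_filter_compl {α : Type*} [Fintype α] [DecidableEq α] {k : ℕ} (hk : 0 < k)
    (hα : 0 < Fintype.card α) (N : Finset (Finset α)) (hN : ∀ U ∈ N, U.card = k) (W : Finset α) :
    (N.card : ℝ) - k * W.card / Fintype.card α * (Fintype.card α).choose k ≤
      ((powersetCard k Wᶜ).filter (· ∈ N)).card := by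
  obtain ⟨l, rfl⟩ : ∃ l, k = l + 1 := ⟨k - 1, by omega⟩
  obtain ⟨p, hp⟩ : ∃ p, Fintype.card α = p + 1 := ⟨Fintype.card α - 1, by omega⟩
  have hsub : N ⊆ (powersetCard (l + 1) Wᶜ).filter (· ∈ N) ∪
      (powersetCard (l + 1) univ \ powersetCard (l + 1) Wᶜ) := by
    intro U hU
    have := hN U hU
    simp only [Finset.mem_union, Finset.mem_filter, Finset.mem_sdiff, Finset.mem_powersetCard,
      Finset.subset_univ]
    tauto
  have h₁ := (Finset.card_le_card hsub).trans (Finset.card_union_le _ _)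
  have h₂ : (powersetCard (l + 1) (univ : Finset α) \ powersetCard (l + 1) Wᶜ).card +
      (Fintype.card α - W.card).choose (l + 1) = (Fintype.card α).choose (l + 1) := by
    rw [← Finset.card_compl, ← Finset.card_powersetCard, ← Finset.card_univ,
      ← Finset.card_powersetCard (l + 1) univ]
    exact Finset.card_sdiff_add_card_eq_card (Finset.powersetCard_mono (Finset.subset_univ _))
  have h₃ := choose_le_choose_sub_add (Fintype.card α) W.card l
  have h₄ := Nat.add_one_mul_choose_eq p l
  rw [hp] at h₂ h₃ ⊢
  rw [Nat.add_sub_cancel] at h₃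
  have h₅ : N.card ≤ ((powersetCard (l + 1) Wᶜ).filter (· ∈ N)).card + W.card * p.choose l := by
    omega
  have h₆ : ((l + 1 : ℕ) : ℝ) * W.card / (p + 1 : ℕ) * (p + 1).choose (l + 1) =
      W.card * p.choose l := by
    have h₄' : ((p + 1 : ℕ) : ℝ) * p.choose l = (p + 1).choose (l + 1) * (l + 1 : ℕ) := by
      exact_mod_cast h₄
    rw [div_mul_eq_mul_div, div_eq_iff (by positivity)]
    linear_combination (-(W.card : ℝ)) * h₄'
  rw [h₆, sub_le_iff_le_add]
  exact_mod_cast h₅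

end Selection

section Estimates

/-- In a `(1,k)`-partite hypergraph the edges at a left vertex are determined by their right part. -/
lemma card_filter_inl_mem_le {ι α : Type*} [DecidableEq ι] [Fintype α] [DecidableEq α] {k : ℕ}
    {H : Finset (Finset (ι ⊕ α))}
    (hH : ∀ e ∈ H, (e.filter fun v => v.isLeft = true).card = 1 ∧ e.card = k + 1) (x : ι) :
    (H.filter fun e => Sum.inl x ∈ e).card ≤
      ((powersetCard k univ).filter fun U => ({x} : Finset ι).disjSum U ∈ H).card := by
  have hedge : ∀ e ∈ H.filter (fun e => Sum.inl x ∈ e),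
      e.toRight.card = k ∧ ({x} : Finset ι).disjSum e.toRight = e := by
    intro e he
    rw [Finset.mem_filter] at he
    obtain ⟨h₁, h₂⟩ := hH e he.1
    have hleft : e.toLeft = {x} := by
      obtain ⟨a, ha⟩ := Finset.card_eq_one.1 h₁
      have hx : Sum.inl x = a := by
        rw [← Finset.mem_singleton, ← ha]
        simp [he.2]
      ext z
      have hz := Finset.ext_iff.1 ha (Sum.inl z)
      simpa [← hx] using hz
    constructor
    · have := e.card_toLeft_add_card_toRight
      rw [hleft, Finset.card_singleton] at this
      omega
    · rw [← hleft, Finset.toLeft_disjSum_toRight]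
  refine Finset.card_le_card_of_injOn Finset.toRight ?_ ?_
  · intro e he
    obtain ⟨h₁, h₂⟩ := hedge e he
    simp only [Finset.coe_filter, Finset.mem_powersetCard, Finset.subset_univ, true_and,
      Set.mem_ofPred_eq]
    exact ⟨h₁, h₂.symm ▸ (Finset.mem_filter.1 he).1⟩
  · intro e he f hf hef
    rw [← (hedge e he).2, ← (hedge f hf).2, hef]

lemma rpow_one_point_five {c : ℝ} (hc : 0 < c) : c ^ (1.5 : ℝ) = c * √c := by
  rw [show (1.5 : ℝ) = 1 + 1 / 2 by norm_num, Real.rpow_add hc, Real.rpow_one, Real.sqrt_eq_rpow]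

lemma sqrt_mul_le_one_of_lt {k : ℕ} {ζ c : ℝ} (hk : 3 ≤ k) (hζ : 0 < ζ) (hζ1 : ζ ≤ 1)
    (hc : c < ζ ^ (2 * k) * ((12 * (k : ℝ) ^ 2 * 2 ^ k * (k.factorial : ℝ) ^ k) ^ 2)⁻¹) :
    96 * (k : ℝ) ^ 2 * √c ≤ 1 ∧ c ≤ ζ / (96 * (k : ℝ) ^ 2) ^ 2 := by
  have hk0 : (0 : ℝ) < k := by exact_mod_cast (by omega : 0 < k)
  have h₁ : (96 : ℝ) * k ^ 2 ≤ 12 * (k : ℝ) ^ 2 * 2 ^ k * (k.factorial : ℝ) ^ k := by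
    have h2 : (2 : ℝ) ^ 3 ≤ 2 ^ k := pow_le_pow_right₀ (by norm_num) hk
    have hf : (1 : ℝ) ≤ (k.factorial : ℝ) ^ k :=
      one_le_pow₀ (by exact_mod_cast k.factorial_pos)
    calc (96 : ℝ) * k ^ 2 = 12 * (k : ℝ) ^ 2 * 2 ^ 3 * 1 := by ring
      _ ≤ _ := by gcongr
  have h₂ : c ≤ ζ / (96 * (k : ℝ) ^ 2) ^ 2 := by
    refine hc.le.trans ?_
    rw [div_eq_mul_inv]
    have hpow : ζ ^ (2 * k) ≤ ζ := by
      simpa using pow_le_pow_of_le_one hζ.le hζ1 (show 1 ≤ 2 * k by omega)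
    gcongr
  refine ⟨?_, h₂⟩
  have h₃ : c ≤ (1 / (96 * (k : ℝ) ^ 2)) ^ 2 := by
    refine h₂.trans ?_
    rw [div_pow, one_pow]
    gcongr
  have h₄ := Real.sqrt_le_sqrt h₃
  rw [Real.sqrt_sq (by positivity)] at h₄
  rw [mul_comm]
  exact (le_div_iff₀ (by positivity)).1 h₄

lemma eventually_log_le_rpow (C : ℝ) :
    ∀ᶠ n : ℕ in Filter.atTop, C * (1 + Real.log n) ≤ (n : ℝ) ^ (1 / 3 : ℝ) := by
  have h₁ : (fun x : ℝ => C * (1 + Real.log x)) =o[Filter.atTop] fun x => x ^ (1 / 3 : ℝ) := by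
    refine Asymptotics.IsLittleO.const_mul_left (Asymptotics.IsLittleO.add ?_ ?_) C
    · exact Asymptotics.isLittleO_const_left.2 (Or.inr
        (tendsto_norm_atTop_atTop.comp (tendsto_rpow_atTop (by norm_num))))
    · exact isLittleO_log_rpow_atTop (by norm_num)
  have h₂ := (h₁.bound one_pos).and (Filter.eventually_ge_atTop 0)
  filter_upwards [tendsto_natCast_atTop_atTop.eventually h₂] with n hn
  have h₃ : (0 : ℝ) ≤ (n : ℝ) ^ (1 / 3 : ℝ) := by positivity
  have h₄ := hn.1
  rw [one_mul, Real.norm_of_nonneg h₃] at h₄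
  exact (le_abs_self _).trans h₄

lemma rpow_third_le_mul {c n : ℝ} (hc : 0 < c) (hn : 0 < n) (h : 2 ≤ c * √c * n) :
    n ^ (1 / 3 : ℝ) ≤ c * n := by
  have hcube : n ≤ (c * n) ^ 3 := by
    have hsq : (c * √c * n) ^ 2 = c ^ 3 * n ^ 2 := by
      rw [mul_pow, mul_pow, Real.sq_sqrt hc.le]; ring
    have h1 : 1 ≤ c ^ 3 * n ^ 2 := by rw [← hsq]; nlinarith
    calc n = 1 * n := (one_mul n).symm
      _ ≤ c ^ 3 * n ^ 2 * n := by gcongr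
      _ = _ := by ring
  calc n ^ (1 / 3 : ℝ) ≤ ((c * n) ^ 3) ^ (1 / 3 : ℝ) := by gcongr
    _ = c * n := by
      rw [← Real.rpow_natCast, ← Real.rpow_mul (by positivity)]
      norm_num

/-- A small exponential potential forces a linear lower bound on the exponent. -/
lemma le_of_inv_two_pow_le {m q : ℕ} {a n : ℝ} (hn : 0 < n) (ha : a ≤ 1)
    (h : (2⁻¹ : ℝ) ^ m ≤ n * (1 - a) ^ q) : q * a - Real.log n ≤ m := by
  have h₁ : Real.exp (-m) ≤ (2⁻¹ : ℝ) ^ m := by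
    rw [show (-m : ℝ) = m * (-1) by ring, Real.exp_nat_mul, Real.exp_neg]
    have := Real.add_one_le_exp 1
    gcongr
    linarith
  have h₂ : (1 - a) ^ q ≤ Real.exp (-(q * a)) := by
    rw [show (-(q * a) : ℝ) = q * (-a) by ring, Real.exp_nat_mul]
    exact pow_le_pow_left₀ (by linarith) (Real.one_sub_le_exp_neg a) q
  have h₃ : Real.exp (-m) ≤ Real.exp (Real.log n + -(q * a)) := by
    rw [Real.exp_add, Real.exp_log hn]
    exact h₁.trans (h.trans (by gcongr))
  have := Real.exp_le_exp.1 h₃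
  linarith

/-- The degree hypothesis yields a neighbourhood of density at least `1 / (4 k ^ 2)`. -/
lemma density_le_of_lt {n k t D : ℕ} (hk : 3 ≤ k) (hn : 12 * k ^ 2 ≤ n)
    (ht : (n : ℝ) / (3 * k ^ 2) ≤ t) (htn : t ≤ n)
    (hD : n.choose k - (n - t + 1).choose k < D) :
    1 / (4 * (k : ℝ) ^ 2) * n.choose k ≤ D := by
  have hk0 : (0 : ℝ) < k := by exact_mod_cast (by omega : 0 < k)
  have hn' : (12 : ℝ) * k ^ 2 ≤ n := by exact_mod_cast hn
  have hn0 : (0 : ℝ) < n := by nlinarith [sq_nonneg (k : ℝ), pow_pos hk0 2]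
  have ht1 : 1 ≤ t := by
    have : (0 : ℝ) < t := lt_of_lt_of_le (by positivity) ht
    exact_mod_cast this
  have h₁ : (n : ℝ) * (n - t + 1).choose k ≤ (n - (t - 1)) * n.choose k := by
    obtain ⟨l, rfl⟩ : ∃ l, k = l + 1 := ⟨k - 1, by omega⟩
    have h := mul_choose_sub_le n (t - 1) l (by omega)
    rw [show n - (t - 1) = n - t + 1 by omega] at h
    have hcast : ((n - t + 1 : ℕ) : ℝ) = n - (t - 1) := by
      rw [Nat.cast_add, Nat.cast_sub htn]; push_cast; ring
    rw [← hcast]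
    exact_mod_cast h
  have h₂ : (n.choose k : ℝ) - (n - t + 1).choose k ≤ D := by
    have : n.choose k ≤ D + (n - t + 1).choose k := by omega
    have : (n.choose k : ℝ) ≤ D + (n - t + 1).choose k := by exact_mod_cast this
    linarith
  have h₃ : (n : ℝ) / (4 * k ^ 2) ≤ t - 1 := by
    have h12 : 1 ≤ (n : ℝ) / (12 * k ^ 2) := (one_le_div (by positivity)).2 hn'
    have hsplit : (n : ℝ) / (3 * k ^ 2) = n / (4 * k ^ 2) + n / (12 * k ^ 2) := by
      field_simp; norm_num
    linarith
  have h₄ : (n : ℝ) * (1 / (4 * (k : ℝ) ^ 2) * n.choose k) ≤ n * D := by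
    calc (n : ℝ) * (1 / (4 * (k : ℝ) ^ 2) * n.choose k) =
        (n : ℝ) / (4 * k ^ 2) * (n.choose k : ℝ) := by ring
      _ ≤ ((t : ℝ) - 1) * (n.choose k : ℝ) := by gcongr
      _ ≤ n * ((n.choose k : ℝ) - (n - t + 1).choose k) := by linarith
      _ ≤ n * D := by gcongr
  exact le_of_mul_le_mul_left h₄ hn0

/-- A set with `k` right vertices per left vertex, in terms of its two parts. -/
lemma card_toRight_eq_of_balanced {ι α : Type*} [DecidableEq ι] [DecidableEq α] {k : ℕ}
    {S : Finset (ι ⊕ α)}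
    (hS : (S.filter fun v => v.isRight = true).card
      = k * (S.filter fun v => v.isLeft = true).card) :
    S.toRight.card = k * S.toLeft.card := by
  have hl : (S.filter fun v => v.isLeft = true) = S.toLeft.map Function.Embedding.inl := by
    ext (a | a) <;> simp
  have hr : (S.filter fun v => v.isRight = true) = S.toRight.map Function.Embedding.inr := by
    ext (a | a) <;> simp
  rwa [hl, hr, Finset.card_map, Finset.card_map] at hS

/-- After `q ≈ c n` selection steps the potential bound guarantees the count needed for
absorbing `c ^ 1.5 * n / 2` edges. -/
lemma half_le_of_inv_two_pow_le {m q : ℕ} {κ c n : ℝ} (hκ : 1 ≤ κ) (hc : 0 < c) (hn : 0 < n)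
    (hsqrt : 96 * κ ^ 2 * √c ≤ 1) (hlog : 32 * κ ^ 2 * (1 + Real.log n) ≤ n ^ (1 / 3 : ℝ))
    (hlarge : 2 ≤ c * √c * n) (hq : c * n - 1 ≤ q)
    (h : (2⁻¹ : ℝ) ^ m ≤ n * (1 - 1 / (16 * κ ^ 2)) ^ q) : c * √c * n / 2 ≤ m := by
  have hκ0 : 0 < κ := by linarith
  have ha : 1 / (16 * κ ^ 2) ≤ 1 := by
    rw [div_le_one (by positivity)]
    nlinarith
  have h₁ := le_of_inv_two_pow_le hn ha h
  have h₂ : 1 + Real.log n ≤ c * n * (1 / (32 * κ ^ 2)) := by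
    rw [mul_one_div, le_div_iff₀ (by positivity), mul_comm]
    exact hlog.trans (rpow_third_le_mul hc hn hlarge)
  have h₃ : c * √c * n / 2 ≤ c * n * (1 / (32 * κ ^ 2)) := by
    have hs : √c ≤ 1 / (16 * κ ^ 2) := by
      rw [le_div_iff₀ (by positivity)]
      nlinarith [mul_nonneg (Real.sqrt_nonneg c) (sq_nonneg κ)]
    calc c * √c * n / 2 = c * n / 2 * √c := by ring
      _ ≤ c * n / 2 * (1 / (16 * κ ^ 2)) := by gcongr
      _ = _ := by field_simp; norm_num
  have h₄ : (c * n - 1) * (1 / (16 * κ ^ 2)) ≤ q * (1 / (16 * κ ^ 2)) := by gcongr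
  have h₅ : 1 / (16 * κ ^ 2) = 2 * (1 / (32 * κ ^ 2)) := by
    field_simp; norm_num
  rw [h₅] at h₁ h₄ ha
  linarith

lemma eighth_le_sub_of_density {κ n c w D C : ℝ} (hκ : 0 < κ) (hn : 0 < n)
    (hC : 0 ≤ C) (hc4 : c * (96 * κ ^ 2) ^ 2 ≤ 1) (hw : w ≤ κ * (c * n))
    (hD : 1 / (4 * κ ^ 2) * C ≤ D) : 1 / (8 * κ ^ 2) * C ≤ D - κ * w / n * C := by
  have h₁ : κ * w / n ≤ 1 / (8 * κ ^ 2) := by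
    rw [div_le_div_iff₀ hn (by positivity)]
    have hck4 : 8 * c * κ ^ 4 ≤ 1 := by nlinarith
    calc κ * w * (8 * κ ^ 2) ≤ κ * (κ * (c * n)) * (8 * κ ^ 2) := by gcongr
      _ = 8 * c * κ ^ 4 * n := by ring
      _ ≤ 1 * n := by gcongr
  have h₂ : 1 / (4 * κ ^ 2) = 1 / (8 * κ ^ 2) + 1 / (8 * κ ^ 2) := by
    field_simp; norm_num
  rw [h₂] at hD
  nlinarith

lemma exists_injOn_fin_ge {β : Type*} [DecidableEq β] (F : Finset β) {t N : ℕ} [Nonempty (Fin N)]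
    (h : F.card + t ≤ N) : ∃ y : β → Fin N, Set.InjOn y F ∧ ∀ U ∈ F, t ≤ (y U : ℕ) := by
  have hlt : ∀ U : F, t + (F.equivFin U : ℕ) < N := fun U => by
    have := (F.equivFin U).isLt
    omega
  refine ⟨fun U => if hU : U ∈ F then ⟨_, hlt ⟨U, hU⟩⟩ else Classical.arbitrary _, ?_, ?_⟩
  · intro U hU V hV hUV
    rw [Finset.mem_coe] at hU hV
    simp only [hU, hV, dif_pos, Fin.mk.injEq, Nat.add_left_cancel_iff, Fin.val_inj,
      EmbeddingLike.apply_eq_iff_eq, Subtype.mk.injEq] at hUV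
    exact hUV
  · intro U hU
    simp [hU]

end Estimates

/-- Lemma 4.2 of the paper (Absorbing Lemma): for `k ≥ 3`, `ζ > 0` and `n` large, if `H` is
a `(1,k)`-partite `(k+1)`-graph with classes `{x_1,…,x_{⌊n/k⌋}}`, `[n]`, whose first `t`
left-vertices (with `n/(3k²) ≤ t ≤ (1-ζ)n/k`) have degree `> C(n,k) - C(n-t+1,k)` and whose
remaining left-vertices have degree `C(n,k)`, then for any `0 < c < ζ^{2k}(12k²2^k(k!)^k)⁻²`
there is a matching `M` in `H` with `|M| ≤ 2kcn` such that every balanced set `S` disjoint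
from `V(M)` with `|S| ≤ (k+1)c^{1.5}n/2` satisfies: `H[V(M) ∪ S]` has a perfect matching. -/
theorem stmt_5 (k : ℕ) (hk : 3 ≤ k) (ζ : ℝ) (hζ : 0 < ζ) :
    ∃ n₁ : ℕ, ∀ n : ℕ, n₁ ≤ n → ∀ t : ℕ,
      (n : ℝ) / (3 * k ^ 2) ≤ t → (t : ℝ) ≤ (1 - ζ) * n / k →
      ∀ H : Finset (Finset (Fin (n / k) ⊕ Fin n)),
        (∀ e ∈ H, (e.filter fun v => v.isLeft = true).card = 1 ∧ e.card = k + 1) →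
        (∀ i : Fin (n / k), (i : ℕ) < t →
          Nat.choose n k - Nat.choose (n - t + 1) k <
            (H.filter fun e => Sum.inl i ∈ e).card) →
        (∀ i : Fin (n / k), t ≤ (i : ℕ) →
          (H.filter fun e => Sum.inl i ∈ e).card = Nat.choose n k) →
        ∀ c : ℝ, 0 < c →
          c < ζ ^ (2 * k) * ((12 * (k : ℝ) ^ 2 * 2 ^ k * ((k.factorial : ℝ)) ^ k) ^ 2)⁻¹ →
          ∃ M ⊆ H, (∀ e ∈ M, ∀ f ∈ M, e ≠ f → Disjoint e f) ∧
            (M.card : ℝ) ≤ 2 * k * c * n ∧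
            ∀ S : Finset (Fin (n / k) ⊕ Fin n),
              Disjoint S (M.biUnion id) →
              (S.filter fun v => v.isRight = true).card
                = k * (S.filter fun v => v.isLeft = true).card →
              (S.card : ℝ) ≤ (k + 1) * c ^ (1.5 : ℝ) * n / 2 →
              ∃ P ⊆ H, (∀ e ∈ P, ∀ f ∈ P, e ≠ f → Disjoint e f) ∧
                P.biUnion id = M.biUnion id ∪ S := by
  obtain ⟨n₁, hn₁⟩ := Filter.eventually_atTop.1
    ((eventually_log_le_rpow (32 * (k : ℝ) ^ 2)).and (Filter.eventually_ge_atTop (12 * k ^ 2)))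
  refine ⟨n₁, fun n hn t ht htζ H hH hlow hfull c hc hcζ => ?_⟩
  obtain ⟨hlog, hnk : 12 * k ^ 2 ≤ n⟩ := hn₁ n hn
  have hk0 : (0 : ℝ) < k := by exact_mod_cast (by omega : 0 < k)
  have hk3 : (3 : ℝ) ≤ k := by exact_mod_cast hk
  have hkn : k ≤ n := by nlinarith
  have hn0 : (0 : ℝ) < n := by exact_mod_cast (by omega : 0 < n)
  have hζ1 : ζ ≤ 1 := by
    by_contra! h
    have h₁ : (1 - ζ) * n / k ≤ 0 :=
      div_nonpos_of_nonpos_of_nonneg (by nlinarith) hk0.le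
    have h₂ : (0 : ℝ) < n / (3 * k ^ 2) := by positivity
    linarith
  have htn : t ≤ n := by
    have h₁ : (1 - ζ) * n / k ≤ n := by
      rw [div_le_iff₀ hk0]
      nlinarith
    exact_mod_cast htζ.trans h₁
  obtain ⟨hsqrt, hcle⟩ := sqrt_mul_le_one_of_lt hk hζ hζ1 hcζ
  rw [rpow_one_point_five hc]
  have hSsmall : ∀ S : Finset (Fin (n / k) ⊕ Fin n), S.toRight.card = k * S.toLeft.card →
      (S.card : ℝ) ≤ (k + 1) * (c * √c) * n / 2 → (S.toLeft.card : ℝ) ≤ c * √c * n / 2 := by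
    intro S hS hcard
    rw [← S.card_toLeft_add_card_toRight, hS] at hcard
    push_cast at hcard
    refine le_of_mul_le_mul_left ?_ (show (0 : ℝ) < k + 1 by positivity)
    linarith
  rcases lt_or_ge (c * √c * n) 2 with hsmall | hlarge
  · refine ⟨∅, by simp, by simp, by simp; positivity, fun S _ hbal hcard => ?_⟩
    have hS := card_toRight_eq_of_balanced hbal
    have hlt : (S.toLeft.card : ℝ) < 1 := by linarith [hSsmall S hS hcard]
    have hzero : S.toLeft.card = 0 := by
      have : S.toLeft.card < 1 := by exact_mod_cast hlt
      omega
    have hempty : S = ∅ := by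
      rw [← Finset.card_eq_zero, ← S.card_toLeft_add_card_toRight, hS, hzero]
      simp
    exact ⟨∅, by simp, by simp, by simp [hempty]⟩
  set q := ⌊c * n⌋₊
  have hqle : (q : ℝ) ≤ c * n := Nat.floor_le (by positivity)
  have hqge : c * n - 1 ≤ q := by linarith [Nat.lt_floor_add_one (c * (n : ℝ))]
  have hqt : q + t ≤ n / k := by
    rw [Nat.le_div_iff_mul_le (by omega)]
    have hck : c * k ≤ ζ := by
      have h₁ : (k : ℝ) ≤ (96 * (k : ℝ) ^ 2) ^ 2 := by nlinarith [pow_pos hk0 2, pow_pos hk0 3]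
      rw [le_div_iff₀ (by positivity)] at hcle
      exact (mul_le_mul_of_nonneg_left h₁ hc.le).trans hcle
    have h₂ : (t : ℝ) * k ≤ (1 - ζ) * n := (le_div_iff₀ hk0).1 htζ
    have h₃ : ((q : ℝ) + t) * k ≤ n := by nlinarith
    exact_mod_cast h₃
  have hpos : 0 < n / k := Nat.div_pos hkn (by omega)
  have : Nonempty (Fin (n / k)) := ⟨⟨0, hpos⟩⟩
  set N : Fin (n / k) → Finset (Finset (Fin n)) := fun x =>
    (powersetCard k univ).filter fun U => ({x} : Finset (Fin (n / k))).disjSum U ∈ H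
  have hNfull : ∀ x : Fin (n / k), t ≤ (x : ℕ) → ∀ V : Finset (Fin n), V.card = k →
      ({x} : Finset (Fin (n / k))).disjSum V ∈ H := by
    intro x hx V hV
    have h₁ := card_filter_inl_mem_le hH x
    rw [hfull x hx] at h₁
    have h₂ : N x = powersetCard k univ :=
      Finset.eq_of_subset_of_card_le (Finset.filter_subset _ _) (by simpa using h₁)
    have h₃ : V ∈ N x := by
      rw [h₂, Finset.mem_powersetCard]
      exact ⟨Finset.subset_univ _, hV⟩
    exact (Finset.mem_filter.1 h₃).2
  have hNdens : ∀ x, 1 / (4 * (k : ℝ) ^ 2) * n.choose k ≤ (N x).card := by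
    intro x
    have h₁ := card_filter_inl_mem_le hH x
    rcases lt_or_ge (x : ℕ) t with hx | hx
    · exact density_le_of_lt hk hnk ht htn ((hlow x hx).trans_le h₁)
    · rw [hfull x hx] at h₁
      have h₂ : (n.choose k : ℝ) ≤ (N x).card := by exact_mod_cast h₁
      have h₃ : 1 / (4 * (k : ℝ) ^ 2) ≤ 1 := by
        rw [div_le_one (by positivity)]
        nlinarith
      nlinarith [Nat.cast_nonneg (α := ℝ) (n.choose k)]
  have hNrobust : ∀ x, ∀ W : Finset (Fin n), W.card ≤ k * q →
      1 / (8 * (k : ℝ) ^ 2) * (Fintype.card (Fin n)).choose k ≤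
        ((powersetCard k Wᶜ).filter (· ∈ N x)).card := by
    intro x W hW
    refine le_trans ?_ (card_sub_le_card_filter_compl (by omega) (by simp; omega) (N x)
      (fun U hU => (Finset.mem_powersetCard.1 (Finset.mem_filter.1 hU).1).2) W)
    rw [Fintype.card_fin]
    have hW' : (W.card : ℝ) ≤ k * (c * n) := by
      have : (W.card : ℝ) ≤ k * q := by exact_mod_cast hW
      exact this.trans (by gcongr)
    have hc4 : c * (96 * (k : ℝ) ^ 2) ^ 2 ≤ 1 :=
      ((le_div_iff₀ (by positivity)).1 hcle).trans hζ1
    exact eighth_le_sub_of_density hk0 hn0 (Nat.cast_nonneg _) hc4 hW' (hNdens x)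
  obtain ⟨F, hFq, hFk, hF, hpot⟩ := exists_pairwiseDisjoint_potential_le (by omega)
    (by simpa using hkn) N (by positivity) hNrobust q le_rfl
  have hcount : ∀ x, c * √c * n / 2 ≤
      (F.filter fun U => ({x} : Finset (Fin (n / k))).disjSum U ∈ H).card := by
    intro x
    have h₁ : (2⁻¹ : ℝ) ^ (F.filter (· ∈ N x)).card ≤ n * (1 - 1 / (16 * (k : ℝ) ^ 2)) ^ q := by
      have hsingle := Finset.single_le_sum
        (f := fun i => (2⁻¹ : ℝ) ^ (F.filter (· ∈ N i)).card) (fun i _ => by positivity)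
        (Finset.mem_univ x)
      refine (hsingle.trans hpot).trans ?_
      rw [Fintype.card_fin, show 1 / (8 * (k : ℝ) ^ 2) / 2 = 1 / (16 * (k : ℝ) ^ 2) by
        field_simp; norm_num]
      have hle : 1 / (16 * (k : ℝ) ^ 2) ≤ 1 := by
        rw [div_le_one (by positivity)]
        nlinarith
      have hnn : (0 : ℝ) ≤ 1 - 1 / (16 * (k : ℝ) ^ 2) := by linarith
      gcongr
      exact_mod_cast Nat.div_le_self n k
    refine (half_le_of_inv_two_pow_le (by linarith) hc hn0 hsqrt hlog hlarge hqge h₁).trans ?_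
    exact_mod_cast Finset.card_le_card
      (Finset.monotone_filter_right F fun U _ hU => (Finset.mem_filter.1 hU).2)
  obtain ⟨y, hyinj, hyt⟩ : ∃ y : Finset (Fin n) → Fin (n / k), Set.InjOn y F ∧
      ∀ U ∈ F, t ≤ (y U : ℕ) :=
    exists_injOn_fin_ge F (by omega)
  have hcomplete : ∀ U ∈ F, ∀ V : Finset (Fin n), V.card = k →
      ({y U} : Finset (Fin (n / k))).disjSum V ∈ H := fun U hU => hNfull (y U) (hyt U hU)
  obtain ⟨M, hMH, hM, hMcard, hMcov⟩ := hasMatchingOn_image F hF hFk hyinj hcomplete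
  refine ⟨M, hMH, hM, ?_, fun S hSM hbal hcard => ?_⟩
  · have h₁ : (M.card : ℝ) ≤ q := by
      exact_mod_cast hMcard.trans (Finset.card_image_le.trans hFq.le)
    have hcn : 0 < c * n := by positivity
    calc (M.card : ℝ) ≤ c * n := h₁.trans hqle
      _ ≤ 2 * k * (c * n) := by nlinarith
      _ = 2 * k * c * n := by ring
  · have hS := card_toRight_eq_of_balanced hbal
    rw [hMcov, Finset.disjoint_left] at hSM
    obtain ⟨P, hPH, hP, -, hPcov⟩ := hasMatchingOn_absorb S.toLeft S.toRight F hF hFk hyinj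
      hcomplete
      (Finset.disjoint_left.2 fun a ha hb => hSM (Finset.mem_toLeft.1 ha) (by simpa using hb))
      (Finset.disjoint_left.2 fun a ha hb => hSM (Finset.mem_toRight.1 ha) (by simpa using hb))
      hS
      (fun x _ => by exact_mod_cast (hSsmall S hS hcard).trans (hcount x))
    refine ⟨P, hPH, hP, ?_⟩
    rw [hPcov, hMcov]
    ext (a | a) <;> simp
end

section
/- For every integer k ≥ 2 there exists ε₀ > 0 such that the following holds for every real ε with 0 < ε < ε₀ and all positive integers n, t with n ≤ 3k²t and n ≥ 40k²/ε. Set a₀ = ε/(8k), a₁ = ε/(24k²), a₂ = ε/(8k²), and let a₃ be any real with 0 < a₃ < ε/(2^k · k! · 30k). Let H be a (1,k)-partite (k+1)-graph with partition classes X, [n], |X| = t, such that d_H(x) ≥ C(n,k) − C(n−t+1,k) − a₃·n^k for every x ∈ X. If H is not ε-close to 𝔉_t(k,n), then e(H[A]) ≥ a₀·e(H) for every A ⊆ V(H) with |A ∩ X| ≥ (t/n − a₁)·n and |A ∩ [n]| ≥ (1 − t/n − a₂)·n. -/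
/-- `H_k(t,n)`: the `k`-graph on `Fin n` whose edges are the `k`-subsets meeting `[t]`. -/
def Hk (n k t : ℕ) : Finset (Finset (Fin n)) :=
  (Finset.univ.powersetCard k).filter fun e => ∃ v ∈ e, (v : ℕ) < t

/-- The `(1,k)`-partite `(k+1)`-graph `𝔉_t(k,n)` with partition classes `Fin t`, `Fin n`. -/
def FtEdges (n k t : ℕ) : Finset (Finset (Fin t ⊕ Fin n)) :=
  Finset.univ.biUnion fun i : Fin t =>
    (Hk n k t).image fun e => insert (Sum.inl i) (e.image Sum.inr)

/-- `E₂` is `ε`-close to `E₁`. -/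
def isClose {V : Type*} [DecidableEq V] (E₁ E₂ : Finset (Finset V)) (ε : ℝ) : Prop :=
  ∃ σ : Equiv.Perm V, ((E₁ \ E₂.image fun e => e.image σ).card : ℝ) ≤ ε * E₁.card

section

open Finset

/-- The `(1,k)`-partite hypergraph whose link at the vertex `i` of the first class is `G i`. -/
def ofLinks {n t : ℕ} (G : Fin t → Finset (Finset (Fin n))) :
    Finset (Finset (Fin t ⊕ Fin n)) :=
  univ.biUnion fun i : Fin t => (G i).image fun e => insert (Sum.inl i) (e.image Sum.inr)

/-- The link of the vertex `x` of the first class, as a `k`-graph on the second class. -/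
def link {n t : ℕ} (k : ℕ) (H : Finset (Finset (Fin t ⊕ Fin n))) (x : Fin t) :
    Finset (Finset (Fin n)) :=
  (powersetCard k univ).filter fun s => insert (Sum.inl x) (s.image Sum.inr) ∈ H

lemma insert_inl_image_inr_inj {n t : ℕ} {x y : Fin t} {s u : Finset (Fin n)}
    (h : (insert (Sum.inl x) (s.image Sum.inr) : Finset (Fin t ⊕ Fin n)) =
      insert (Sum.inl y) (u.image Sum.inr)) : x = y ∧ s = u := by
  constructor
  · have : Sum.inl x ∈ (insert (Sum.inl y) (u.image Sum.inr) : Finset (Fin t ⊕ Fin n)) := by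
      rw [← h]; simp
    simpa using this
  · ext v
    have := Finset.ext_iff.mp h (Sum.inr v)
    simpa using this

lemma card_ofLinks {n t : ℕ} (G : Fin t → Finset (Finset (Fin n))) :
    (ofLinks G).card = ∑ x, (G x).card := by
  rw [ofLinks, card_biUnion]
  · refine sum_congr rfl fun x _ => card_image_of_injective _ fun s u h => ?_
    exact (insert_inl_image_inr_inj h).2
  · intro x _ y _ hxy
    simp only [Function.onFun, disjoint_left, mem_image]
    rintro _ ⟨s, _, rfl⟩ ⟨u, _, h⟩
    exact hxy (insert_inl_image_inr_inj h).1.symm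

lemma mem_ofLinks {n t : ℕ} {G : Fin t → Finset (Finset (Fin n))} {e : Finset (Fin t ⊕ Fin n)} :
    e ∈ ofLinks G ↔ ∃ x, ∃ s ∈ G x, insert (Sum.inl x) (s.image Sum.inr) = e := by
  simp [ofLinks]

lemma exists_insert_inl_image_inr {n t k : ℕ} {e : Finset (Fin t ⊕ Fin n)}
    (h1 : (e.filter fun v => v.isLeft = true).card = 1) (h2 : e.card = k + 1) :
    ∃ (x : Fin t) (s : Finset (Fin n)), s.card = k ∧
      insert (Sum.inl x) (s.image Sum.inr) = e := by
  obtain ⟨a, ha⟩ := card_eq_one.mp h1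
  have hmem : a ∈ e.filter fun v => v.isLeft = true := by rw [ha]; simp
  obtain ⟨x, rfl⟩ : ∃ x, a = Sum.inl x := Sum.isLeft_iff.mp (mem_filter.mp hmem).2
  have heq : insert (Sum.inl x) (e.toRight.image Sum.inr) = e := by
    ext v
    rcases v with y | v
    · have := Finset.ext_iff.mp ha (Sum.inl y)
      simp at this
      simp [this]
    · simp
  refine ⟨x, e.toRight, ?_, heq⟩
  have hc := congrArg card heq
  rw [card_insert_of_notMem (by simp), card_image_of_injective _ Sum.inr_injective, h2] at hc
  omega

lemma ofLinks_link {n t k : ℕ} {H : Finset (Finset (Fin t ⊕ Fin n))}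
    (hH : ∀ e ∈ H, (e.filter fun v => v.isLeft = true).card = 1 ∧ e.card = k + 1) :
    ofLinks (link k H) = H := by
  ext e
  rw [mem_ofLinks]
  constructor
  · rintro ⟨x, s, hs, rfl⟩
    exact (mem_filter.mp hs).2
  · intro he
    obtain ⟨x, s, hs, rfl⟩ := exists_insert_inl_image_inr (hH e he).1 (hH e he).2
    exact ⟨x, s, mem_filter.mpr ⟨mem_powersetCard.mpr ⟨subset_univ _, hs⟩, he⟩, rfl⟩

lemma card_filter_inl_mem {n t k : ℕ} {H : Finset (Finset (Fin t ⊕ Fin n))}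
    (hH : ∀ e ∈ H, (e.filter fun v => v.isLeft = true).card = 1 ∧ e.card = k + 1) (x : Fin t) :
    (H.filter fun e => Sum.inl x ∈ e).card = (link k H x).card := by
  have : (H.filter fun e => Sum.inl x ∈ e) =
      (link k H x).image fun s => insert (Sum.inl x) (s.image Sum.inr) := by
    ext e
    simp only [mem_filter, mem_image, link]
    constructor
    · rintro ⟨he, hx⟩
      obtain ⟨y, s, hs, rfl⟩ := exists_insert_inl_image_inr (hH e he).1 (hH e he).2
      obtain rfl : x = y := by simpa using hx
      exact ⟨s, ⟨mem_powersetCard.mpr ⟨subset_univ _, hs⟩, he⟩, rfl⟩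
    · rintro ⟨s, ⟨_, hs⟩, rfl⟩
      exact ⟨hs, by simp⟩
  rw [this, card_image_of_injective _ fun s u h => (insert_inl_image_inr_inj h).2]

lemma sum_card_link_inter_le {n t k : ℕ} (H : Finset (Finset (Fin t ⊕ Fin n)))
    (A : Finset (Fin t ⊕ Fin n)) :
    ∑ x ∈ A.toLeft, (link k H x ∩ powersetCard k A.toRight).card ≤
      (H.filter fun e => e ⊆ A).card := by
  classical
  let G : Fin t → Finset (Finset (Fin n)) := fun x =>
    if x ∈ A.toLeft then link k H x ∩ powersetCard k A.toRight else ∅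
  have hG : ∑ x ∈ A.toLeft, (link k H x ∩ powersetCard k A.toRight).card =
      (ofLinks G).card := by
    rw [card_ofLinks, ← sum_subset (subset_univ A.toLeft)]
    · exact sum_congr rfl fun x hx => by simp only [G, if_pos hx]
    · intro x _ hx
      simp only [G, if_neg hx, card_empty]
  rw [hG]
  refine card_le_card fun e he => ?_
  obtain ⟨x, s, hs, rfl⟩ := mem_ofLinks.mp he
  by_cases hx : x ∈ A.toLeft
  · simp only [G, if_pos hx, mem_inter, link, mem_filter, mem_powersetCard] at hs
    refine mem_filter.mpr ⟨hs.1.2, ?_⟩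
    intro v hv
    rcases mem_insert.mp hv with rfl | hv
    · simpa using hx
    · obtain ⟨w, hw, rfl⟩ := mem_image.mp hv
      simpa using hs.2.1 hw
  · simp only [G, if_neg hx, notMem_empty] at hs

/-- Every set of `n - t` vertices is the complement of `[t]` up to a permutation. -/
lemma exists_perm_mem_iff_le {n t : ℕ} {B : Finset (Fin n)} (hB : B.card = n - t) :
    ∃ τ : Equiv.Perm (Fin n), ∀ v, v ∈ B ↔ t ≤ (τ v : ℕ) := by
  classical
  have hcard : Fintype.card {v // v ∈ B} = Fintype.card {v : Fin n // t ≤ (v : ℕ)} := by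
    rw [Fintype.card_coe, hB, Fintype.card_subtype]
    by_cases h : t < n
    · have : (univ.filter fun v : Fin n => t ≤ (v : ℕ)) = Ici (⟨t, h⟩ : Fin n) := by
        ext v; simp [Fin.le_def]
      rw [this, Fin.card_Ici]
    · rw [filter_false_of_mem (fun v _ => by have := v.2; omega)]
      simp; omega
  let f := Fintype.equivOfCardEq hcard
  refine ⟨f.extendSubtype, fun v => ⟨fun hv => f.extendSubtype_mem v hv, fun hv => ?_⟩⟩
  by_contra hn
  exact f.extendSubtype_not_mem v hn hv

lemma Hk_eq_image {n t k : ℕ} {B : Finset (Fin n)} (τ : Equiv.Perm (Fin n))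
    (hτ : ∀ v, v ∈ B ↔ t ≤ (τ v : ℕ)) :
    Hk n k t = (powersetCard k univ \ powersetCard k B).image fun s => s.image τ := by
  ext e
  simp only [Hk, mem_filter, mem_image, mem_sdiff, mem_powersetCard, subset_univ, true_and]
  constructor
  · rintro ⟨he, v, hv, hvt⟩
    refine ⟨e.image τ.symm, ⟨?_, ?_⟩, ?_⟩
    · rw [card_image_of_injective _ τ.symm.injective, he]
    · rintro ⟨h, _⟩
      have := (hτ _).mp (h (mem_image_of_mem τ.symm hv))
      rw [Equiv.apply_symm_apply] at this
      omega
    · simp [image_image]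
  · rintro ⟨s, ⟨hs, hsB⟩, rfl⟩
    refine ⟨by rw [card_image_of_injective _ τ.injective, hs], ?_⟩
    have : ¬ s ⊆ B := fun h => hsB ⟨h, hs⟩
    obtain ⟨v, hv, hvB⟩ := not_subset.mp this
    refine ⟨τ v, mem_image_of_mem _ hv, ?_⟩
    rw [hτ] at hvB
    omega

lemma card_Hk {n t k : ℕ} {B : Finset (Fin n)} (hB : B.card = n - t) :
    (Hk n k t).card = (powersetCard k univ \ powersetCard k B).card := by
  obtain ⟨τ, hτ⟩ := exists_perm_mem_iff_le hB
  rw [Hk_eq_image τ hτ, card_image_of_injective _ (image_injective τ.injective)]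

lemma card_FtEdges (n k t : ℕ) : (FtEdges n k t).card = t * (Hk n k t).card := by
  have := card_ofLinks (t := t) fun _ => Hk n k t
  simpa [ofLinks, FtEdges] using this

lemma exists_perm_card_FtEdges_sdiff_le {n t : ℕ} (k : ℕ) (H : Finset (Finset (Fin t ⊕ Fin n)))
    {B : Finset (Fin n)} (hB : B.card = n - t) :
    ∃ σ : Equiv.Perm (Fin t ⊕ Fin n),
      (FtEdges n k t \ H.image fun e => e.image σ).card ≤
        ∑ x, ((powersetCard k univ \ powersetCard k B) \ link k H x).card := by
  obtain ⟨τ, hτ⟩ := exists_perm_mem_iff_le hB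
  refine ⟨Equiv.sumCongr (Equiv.refl _) τ, ?_⟩
  let G : Fin t → Finset (Finset (Fin n)) := fun x =>
    ((powersetCard k univ \ powersetCard k B) \ link k H x).image fun s => s.image τ
  have hG : (ofLinks G).card =
      ∑ x, ((powersetCard k univ \ powersetCard k B) \ link k H x).card := by
    rw [card_ofLinks]
    exact sum_congr rfl fun x _ => card_image_of_injective _ (image_injective τ.injective)
  rw [← hG]
  refine card_le_card fun e he => ?_
  obtain ⟨heF, heH⟩ := mem_sdiff.mp he
  obtain ⟨x, s, hs, rfl⟩ := (mem_ofLinks (G := fun _ => Hk n k t)).mp heF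
  rw [Hk_eq_image τ hτ] at hs
  obtain ⟨u, hu, rfl⟩ := mem_image.mp hs
  refine mem_ofLinks.mpr ⟨x, _, mem_image_of_mem _ (mem_sdiff.mpr ⟨hu, fun hul => heH ?_⟩), rfl⟩
  refine mem_image.mpr ⟨_, (mem_filter.mp hul).2, ?_⟩
  ext v
  simp [image_insert, image_image, Function.comp_def]

lemma card_sdiff_link_add {n t k : ℕ} (H : Finset (Finset (Fin t ⊕ Fin n))) (B : Finset (Fin n))
    (x : Fin t) :
    ((powersetCard k univ \ powersetCard k B) \ link k H x).card + (link k H x).card =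
      (powersetCard k univ \ powersetCard k B).card + (link k H x ∩ powersetCard k B).card := by
  have hsub : link k H x ⊆ powersetCard k univ := filter_subset _ _
  have h1 := card_sdiff_add_card_inter (powersetCard k univ \ powersetCard k B) (link k H x)
  have h2 := card_sdiff_add_card_inter (link k H x) (powersetCard k B)
  have h3 : (powersetCard k univ \ powersetCard k B) ∩ link k H x =
      link k H x \ powersetCard k B := by
    ext s
    simp only [mem_inter, mem_sdiff]
    exact ⟨fun h => ⟨h.2, h.1.2⟩, fun h => ⟨⟨hsub h.1, h.2⟩, h.1⟩⟩
  rw [h3] at h1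
  omega

/-- At most `|U| * C(n-1, k)` of the `(k+1)`-subsets of an `n`-set meet `U`. -/
lemma card_powersetCard_filter_meet_le {n k : ℕ} (U : Finset (Fin n)) :
    ((powersetCard (k + 1) univ).filter fun s : Finset (Fin n) => ∃ v ∈ s, v ∈ U).card ≤
      U.card * (n - 1).choose k := by
  have hsub : ((powersetCard (k + 1) univ).filter fun s : Finset (Fin n) => ∃ v ∈ s, v ∈ U) ⊆
      U.biUnion fun v => (powersetCard k (univ.erase v)).image fun s => insert v s := by
    intro s hs
    simp only [mem_filter, mem_powersetCard, subset_univ, true_and] at hs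
    obtain ⟨hs, v, hv, hvU⟩ := hs
    refine mem_biUnion.mpr ⟨v, hvU, mem_image.mpr ⟨s.erase v, mem_powersetCard.mpr ⟨?_, ?_⟩, ?_⟩⟩
    · exact erase_subset_erase _ (subset_univ _)
    · rw [card_erase_of_mem hv, hs]; rfl
    · exact insert_erase hv
  refine (card_le_card hsub).trans (card_biUnion_le_card_mul _ _ _ fun v _ => ?_)
  refine card_image_le.trans ?_
  rw [card_powersetCard, card_erase_of_mem (mem_univ v), card_univ, Fintype.card_fin]

lemma card_inter_powersetCard_le {n k : ℕ} {N : Finset (Finset (Fin n))}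
    (B B' : Finset (Fin n)) :
    (N ∩ powersetCard (k + 1) B').card ≤
      (N ∩ powersetCard (k + 1) B).card + (B' \ B).card * (n - 1).choose k := by
  refine (card_le_card ?_).trans ((card_union_le _ _).trans
    (Nat.add_le_add_left (card_powersetCard_filter_meet_le (B' \ B)) _))
  intro s hs
  simp only [mem_inter, mem_powersetCard, mem_union, mem_filter, subset_univ, true_and] at hs ⊢
  by_cases h : s ⊆ B
  · exact Or.inl ⟨hs.1, h, hs.2.2⟩
  · obtain ⟨v, hv, hvB⟩ := not_subset.mp h
    exact Or.inr ⟨hs.2.2, v, hv, mem_sdiff.mpr ⟨hs.2.1 hv, hvB⟩⟩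

lemma choose_add_mul_choose_le (m t k : ℕ) :
    m.choose (k + 1) + t * m.choose k ≤ (m + t).choose (k + 1) := by
  induction t with
  | zero => simp
  | succ t ih =>
    rw [← add_assoc, Nat.choose_succ_succ (m + t) k]
    have := Nat.choose_le_choose k (Nat.le_add_right m t)
    linarith

lemma choose_sub_mul_le {n t k : ℕ} (h : n ≤ 3 * (k + 1) ^ 2 * t) :
    (n - t).choose (k + 1) * (3 * (k + 1) + 1) ≤ 3 * (k + 1) * n.choose (k + 1) := by
  rcases le_or_gt n t with hnt | hnt
  · simp [Nat.sub_eq_zero_of_le hnt]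
  obtain ⟨m, rfl⟩ := Nat.exists_eq_add_of_lt hnt
  have hm : t + m + 1 - t = m + 1 := by omega
  rw [hm]
  have h1 := choose_add_mul_choose_le (m + 1) t k
  rw [show m + 1 + t = t + m + 1 by ring] at h1
  have h2 := Nat.choose_succ_right_eq (m + 1) k
  have h3 : (m + 1).choose (k + 1) * (k + 1) ≤ (m + 1).choose k * (3 * (k + 1) ^ 2 * t) := by
    rw [h2]
    exact Nat.mul_le_mul_left _ (by omega)
  have h4 : (m + 1).choose (k + 1) ≤ (m + 1).choose k * (3 * (k + 1) * t) := by
    refine Nat.le_of_mul_le_mul_right (c := k + 1) (h3.trans (le_of_eq ?_)) (Nat.succ_pos k)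
    ring
  nlinarith

lemma pow_le_two_pow_mul_factorial_mul_choose {n k : ℕ} (h : 2 * k ≤ n) :
    n ^ k ≤ 2 ^ k * k.factorial * n.choose k := by
  have h1 := Nat.pow_sub_le_descFactorial n k
  rw [Nat.descFactorial_eq_factorial_mul_choose] at h1
  calc n ^ k ≤ (2 * (n + 1 - k)) ^ k := Nat.pow_le_pow_left (by omega) k
    _ = 2 ^ k * (n + 1 - k) ^ k := mul_pow _ _ _
    _ ≤ 2 ^ k * (k.factorial * n.choose k) := Nat.mul_le_mul_left _ h1
    _ = _ := by ring

lemma exists_card_eq_and_card_sdiff_eq {n m : ℕ} (B : Finset (Fin n)) (hm : m ≤ n) :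
    ∃ B' : Finset (Fin n), B'.card = m ∧ (B' \ B).card = m - B.card := by
  rcases le_total m B.card with h | h
  · obtain ⟨B', hB', hc⟩ := exists_subset_card_eq h
    exact ⟨B', hc, by rw [sdiff_eq_empty_iff_subset.mpr hB', card_empty]; omega⟩
  · obtain ⟨B', hB', hc⟩ := exists_superset_card_eq h (by simpa using hm)
    exact ⟨B', hc, by rw [card_sdiff_of_subset hB', hc]⟩

/-- The numerical estimate: `t` vertices, `p` of them in the dense part, `C` the number of all
`k`-sets, `D` the degree in the extremal graph, `h = e(H)`, `S` the number of edges avoiding the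
extremal core. -/
lemma missing_le {κ ε t p C D h S Z M : ℝ} (hκ : 2 ≤ κ) (hε : 0 < ε) (hε' : ε < 1 / 4)
    (ht : 0 < t) (hp : t - p ≤ ε / 8 * t) (hpt : p ≤ t) (hC : 0 < C)
    (hD : C ≤ (3 * κ + 1) * D)
    (hh : h ≤ t * C) (hh' : h ≤ t * D + S + (t - p) * C)
    (hS : S ≤ ε / (8 * κ) * h + t * (ε / (8 * κ) * C))
    (hZ : Z ≤ ε / (40 * κ) * C + ε / (30 * κ) * C) (hZ0 : 0 ≤ Z)
    (hM : M ≤ (t - p) * D + p * Z + S) : M ≤ ε * (t * D) := by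
  have hκ0 : 0 < κ := by linarith
  set b := C / κ with hb
  have hCb : C = κ * b := by rw [hb]; field_simp
  have hb0 : 0 < b := div_pos hC hκ0
  have hbC : 2 * b ≤ C := by rw [hCb]; nlinarith
  have hD0 : 0 ≤ D := by nlinarith
  have hDb : 2 / 7 * b ≤ D := by nlinarith
  have e1 : ε / (40 * κ) * C = ε / 40 * b := by rw [hb]; field_simp
  have e2 : ε / (30 * κ) * C = ε / 30 * b := by rw [hb]; field_simp
  have e3 : ε / (8 * κ) * C = ε / 8 * b := by rw [hb]; field_simp
  rw [e1, e2] at hZ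
  rw [e3] at hS
  have htC : 0 < t * C := mul_pos ht hC
  have htb : 0 < t * b := mul_pos ht hb0
  have htD : 0 ≤ t * D := mul_nonneg ht.le hD0
  have hi : ε / (8 * κ) ≤ ε / 16 := by gcongr; linarith
  have hi0 : 0 < ε / (8 * κ) := by positivity
  have a1 : ε / (8 * κ) * h ≤ ε / (8 * κ) * (t * C) := by gcongr
  have a2 : ε / (8 * κ) * (t * C) = ε / 8 * (t * b) := by rw [hb]; field_simp
  have a3 : (t - p) * C ≤ ε / 8 * (t * C) := by nlinarith
  have a4 : (t - p) * D ≤ ε / 8 * (t * D) := by nlinarith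
  have a5 : p * Z ≤ t * (ε / 40 * b + ε / 30 * b) := by gcongr
  have a0 : ε * (t * (2 * b)) ≤ ε * (t * C) := by gcongr
  have hh2 : h ≤ t * D + ε * (t * C) := by linarith [mul_pos hε htC]
  have a6 : ε / (8 * κ) * h ≤ ε / 16 * (t * D) + ε * (ε / 8 * (t * b)) := by
    calc ε / (8 * κ) * h ≤ ε / (8 * κ) * (t * D + ε * (t * C)) := by gcongr
      _ = ε / (8 * κ) * (t * D) + ε * (ε / (8 * κ) * (t * C)) := by ring
      _ ≤ _ := by rw [a2]; gcongr
  have a7 : ε * (ε / 8 * (t * b)) ≤ ε / 32 * (t * b) := by nlinarith [mul_pos hε htb]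
  have a8 : t * b * (2 / 7) ≤ t * D := by nlinarith
  have a9 : ε * (t * b * (2 / 7)) ≤ ε * (t * D) := by gcongr
  have a10 : 0 < ε * (t * b) := mul_pos hε htb
  linarith

lemma card_filter_isLeft {n t : ℕ} (A : Finset (Fin t ⊕ Fin n)) :
    (A.filter fun v => v.isLeft = true).card = A.toLeft.card := by
  rw [← card_image_of_injective A.toLeft (Sum.inl_injective (β := Fin n))]
  congr 1
  ext v
  rcases v with v | v <;> simp

lemma card_filter_isRight {n t : ℕ} (A : Finset (Fin t ⊕ Fin n)) :
    (A.filter fun v => v.isRight = true).card = A.toRight.card := by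
  rw [← card_image_of_injective A.toRight (Sum.inr_injective (α := Fin t))]
  congr 1
  ext v
  rcases v with v | v <;> simp

end

/-- Lemma 5.1 of the paper: for `k ≥ 2` there is `ε₀ > 0` such that for `0 < ε < ε₀`,
`n ≤ 3k²t`, `n ≥ 40k²/ε`, with `a₀ = ε/8k`, `a₁ = ε/24k²`, `a₂ = ε/8k²` and any
`0 < a₃ < ε/(2^k·k!·30k)`: if `H` is `(1,k)`-partite with classes `X` (`|X| = t`), `[n]`,
`d_H(x) ≥ C(n,k) - C(n-t+1,k) - a₃n^k` for all `x ∈ X`, and `H` is not `ε`-close to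
`𝔉_t(k,n)`, then `H` is `(𝒜, a₀)`-dense: `e(H[A]) ≥ a₀·e(H)` for every `A` with
`|A ∩ X| ≥ (t/n - a₁)n` and `|A ∩ [n]| ≥ (1 - t/n - a₂)n`. -/
theorem stmt_7 (k : ℕ) (hk : 2 ≤ k) :
    ∃ ε₀ : ℝ, 0 < ε₀ ∧ ∀ ε : ℝ, 0 < ε → ε < ε₀ →
    ∀ n t : ℕ, 0 < n → 0 < t → n ≤ 3 * k ^ 2 * t → 40 * (k : ℝ) ^ 2 / ε ≤ (n : ℝ) →
    ∀ a₃ : ℝ, 0 < a₃ → a₃ < ε / (2 ^ k * (k.factorial : ℝ) * (30 * k)) →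
    ∀ H : Finset (Finset (Fin t ⊕ Fin n)),
      (∀ e ∈ H, (e.filter fun v => v.isLeft = true).card = 1 ∧ e.card = k + 1) →
      (∀ x : Fin t,
        (Nat.choose n k : ℝ) - (Nat.choose (n - t + 1) k : ℝ) - a₃ * (n : ℝ) ^ k ≤
          ((H.filter fun e => Sum.inl x ∈ e).card : ℝ)) →
      ¬ isClose (FtEdges n k t) H ε →
      ∀ A : Finset (Fin t ⊕ Fin n),
        ((t : ℝ) / n - ε / (24 * k ^ 2)) * n ≤ ((A.filter fun v => v.isLeft = true).card : ℝ) →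
        (1 - (t : ℝ) / n - ε / (8 * k ^ 2)) * n ≤ ((A.filter fun v => v.isRight = true).card : ℝ) →
        ε / (8 * k) * (H.card : ℝ) ≤ ((H.filter fun e => e ⊆ A).card : ℝ) := by
  obtain ⟨j, rfl⟩ : ∃ j, k = j + 1 := ⟨k - 1, by omega⟩
  refine ⟨1 / 4, by norm_num, ?_⟩
  intro ε hε hε' n t hn ht hnt hnε a₃ ha₃ ha₃' H hH hdeg hclose A hAl hAr
  by_contra! hlt
  apply hclose
  rw [card_filter_isLeft] at hAl
  rw [card_filter_isRight] at hAr
  set k := j + 1 with hkdef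
  have hkR : (2 : ℝ) ≤ k := by exact_mod_cast hk
  have hnR : (0 : ℝ) < n := by exact_mod_cast hn
  have htR : (0 : ℝ) < t := by exact_mod_cast ht
  have hnε' : 40 * (k : ℝ) ^ 2 ≤ ε * n := by
    rw [div_le_iff₀ hε] at hnε; linarith
  have hn2k : 2 * k ≤ n := by
    have : (2 * k : ℝ) ≤ n := by nlinarith
    exact_mod_cast this
  have hntR : (n : ℝ) ≤ 3 * k ^ 2 * t := by exact_mod_cast hnt
  obtain ⟨B', hB', hB'A⟩ := exists_card_eq_and_card_sdiff_eq A.toRight (Nat.sub_le n t)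
  obtain ⟨σ, hσ⟩ := exists_perm_card_FtEdges_sdiff_le k H hB'
  refine ⟨σ, ?_⟩
  rw [card_FtEdges, card_Hk hB', Nat.cast_mul]
  set P : Finset (Finset (Fin n)) :=
    Finset.powersetCard k Finset.univ \ Finset.powersetCard k B' with hP
  have hPcard : P.card + (n - t).choose k = n.choose k := by
    have := Finset.card_sdiff_add_card_eq_card
      (Finset.powersetCard_mono (n := k) (Finset.subset_univ B'))
    simpa [← hP, hB'] using this
  have hPcardR : (P.card : ℝ) + ((n - t).choose k : ℝ) = n.choose k := by exact_mod_cast hPcard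
  have hCpos : (0 : ℝ) < n.choose k := by exact_mod_cast Nat.choose_pos (by omega)
  have hnC : (n : ℝ) * (n - 1).choose j = k * n.choose k := by
    have := Nat.add_one_mul_choose_eq (n - 1) j
    rw [Nat.sub_add_cancel hn] at this
    rw [mul_comm (k : ℝ)]
    exact_mod_cast this
  have hεkn : ε / (8 * k ^ 2) * n * (n - 1).choose j = ε / (8 * k) * n.choose k := by
    rw [mul_assoc, hnC]; field_simp
  have hp : (t : ℝ) - A.toLeft.card ≤ ε / 8 * t := by
    have h1 : ((t : ℝ) / n - ε / (24 * k ^ 2)) * n = t - ε / (24 * k ^ 2) * n := by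
      field_simp
    have h2 : ε / (24 * k ^ 2) * n ≤ ε / (24 * k ^ 2) * (3 * k ^ 2 * t) := by gcongr
    have h3 : ε / (24 * k ^ 2) * (3 * k ^ 2 * t) = ε / 8 * t := by field_simp; norm_num
    linarith
  have hpt : A.toLeft.card ≤ t := by
    simpa using Finset.card_le_univ A.toLeft
  have hB'A' : ((B' \ A.toRight).card : ℝ) ≤ ε / (8 * k ^ 2) * n := by
    have h1 : (1 - (t : ℝ) / n - ε / (8 * k ^ 2)) * n = n - t - ε / (8 * k ^ 2) * n := by
      field_simp
    have h0 : 0 ≤ ε / (8 * k ^ 2) * n := by positivity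
    rw [hB'A]
    rcases le_or_gt (n - t) A.toRight.card with h | h
    · simpa [Nat.sub_eq_zero_of_le h] using h0
    · rw [Nat.cast_sub h.le, Nat.cast_sub (by omega)]
      linarith
  have hD : (n.choose k : ℝ) ≤ (3 * k + 1) * P.card := by
    have h1 : (((n - t).choose k : ℝ)) * (3 * k + 1) ≤ 3 * k * n.choose k := by
      exact_mod_cast choose_sub_mul_le hnt
    nlinarith
  have hlinkC : ∀ x, (link k H x).card ≤ n.choose k := fun x => by
    have h : link k H x ⊆ Finset.powersetCard k Finset.univ := Finset.filter_subset _ _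
    simpa using Finset.card_le_card h
  have hHsum : H.card = ∑ x, (link k H x).card := by
    rw [← card_ofLinks, ofLinks_link hH]
  have hlinkD : ∀ x, (link k H x).card ≤
      P.card + (link k H x ∩ Finset.powersetCard k B').card := fun x => by
    have := card_sdiff_link_add (k := k) H B' x
    rw [← hP] at this
    omega
  have hsplit : ∀ f : Fin t → ℕ, ∑ x, f x = ∑ x ∈ A.toLeft, f x + ∑ x ∈ A.toLeftᶜ, f x :=
    fun f => (Finset.sum_add_sum_compl _ f).symm
  have hcompl : (A.toLeftᶜ).card = t - A.toLeft.card := by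
    rw [Finset.card_compl, Fintype.card_fin]
  have hcomplR : ((A.toLeftᶜ).card : ℝ) = t - A.toLeft.card := by
    rw [hcompl, Nat.cast_sub hpt]
  set S : ℕ := ∑ x ∈ A.toLeft, (link k H x ∩ Finset.powersetCard k B').card with hSdef
  have hS : (S : ℝ) ≤ ε / (8 * k) * H.card + t * (ε / (8 * k) * n.choose k) := by
    have h1 : S ≤ (H.filter fun e => e ⊆ A).card +
        t * ((B' \ A.toRight).card * (n - 1).choose j) := by
      calc S ≤ ∑ x ∈ A.toLeft, ((link k H x ∩ Finset.powersetCard k A.toRight).card +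
            (B' \ A.toRight).card * (n - 1).choose j) :=
            Finset.sum_le_sum fun x _ => card_inter_powersetCard_le _ _
        _ = ∑ x ∈ A.toLeft, (link k H x ∩ Finset.powersetCard k A.toRight).card +
            A.toLeft.card * ((B' \ A.toRight).card * (n - 1).choose j) := by
            rw [Finset.sum_add_distrib, Finset.sum_const, smul_eq_mul]
        _ ≤ _ := Nat.add_le_add (sum_card_link_inter_le H A) (Nat.mul_le_mul_right _ hpt)
    have h2 : (S : ℝ) ≤ ((H.filter fun e => e ⊆ A).card : ℝ) +
        t * ((B' \ A.toRight).card * (n - 1).choose j) := by exact_mod_cast h1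
    have h3 : (t : ℝ) * ((B' \ A.toRight).card * (n - 1).choose j) ≤
        t * (ε / (8 * k ^ 2) * n * (n - 1).choose j) := by gcongr
    rw [hεkn] at h3
    linarith
  have hh : (H.card : ℝ) ≤ t * n.choose k := by
    have : H.card ≤ t * n.choose k := by
      rw [hHsum]
      simpa using Finset.sum_le_card_nsmul Finset.univ _ _ fun x _ => hlinkC x
    exact_mod_cast this
  have hh' : (H.card : ℝ) ≤ t * P.card + S + (t - A.toLeft.card) * n.choose k := by
    have h1 : H.card ≤ A.toLeft.card * P.card + S + (A.toLeftᶜ).card * n.choose k := by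
      rw [hHsum, hsplit]
      refine Nat.add_le_add ?_ ?_
      · refine (Finset.sum_le_sum fun x _ => hlinkD x).trans (le_of_eq ?_)
        rw [Finset.sum_add_distrib, Finset.sum_const, smul_eq_mul]
      · simpa using Finset.sum_le_card_nsmul A.toLeftᶜ _ _ fun x _ => hlinkC x
    have h2 : (H.card : ℝ) ≤ A.toLeft.card * P.card + S + (A.toLeftᶜ).card * n.choose k := by
      exact_mod_cast h1
    have h3 : (A.toLeft.card : ℝ) * P.card ≤ t * P.card := by gcongr
    rw [hcomplR] at h2
    linarith
  have hpascal : (n - t + 1).choose k = (n - t).choose j + (n - t).choose k :=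
    Nat.choose_succ_succ _ _
  have hZ : ((n - t).choose j : ℝ) + a₃ * n ^ k ≤
      ε / (40 * k) * n.choose k + ε / (30 * k) * n.choose k := by
    refine add_le_add ?_ ?_
    · have h1 : ((n - t).choose j : ℝ) ≤ (n - 1).choose j := by
        exact_mod_cast Nat.choose_le_choose j (by omega)
      have h2 : ((n - 1).choose j : ℝ) = k * n.choose k / n := by
        rw [← hnC]; field_simp
      refine h1.trans ?_
      rw [h2, div_le_iff₀ hnR]
      have h3 : ε / (40 * k) * n.choose k * n = n.choose k / (40 * k) * (ε * n) := by ring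
      have h4 : (k : ℝ) * n.choose k = n.choose k / (40 * k) * (40 * k ^ 2) := by field_simp
      rw [h3, h4]
      gcongr
    · have h1 : (n : ℝ) ^ k ≤ 2 ^ k * k.factorial * n.choose k := by
        exact_mod_cast pow_le_two_pow_mul_factorial_mul_choose hn2k
      calc a₃ * (n : ℝ) ^ k
          ≤ ε / (2 ^ k * k.factorial * (30 * k)) * (2 ^ k * k.factorial * n.choose k) := by
            gcongr
        _ = ε / (30 * k) * n.choose k := by
            have : (k.factorial : ℝ) ≠ 0 := by exact_mod_cast k.factorial_ne_zero
            field_simp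
  have hmiss : ∀ x, ((P \ link k H x).card : ℝ) ≤
      ((n - t).choose j + a₃ * n ^ k) + (link k H x ∩ Finset.powersetCard k B').card := fun x => by
    have h1 : ((P \ link k H x).card : ℝ) + (link k H x).card =
        P.card + (link k H x ∩ Finset.powersetCard k B').card := by
      exact_mod_cast card_sdiff_link_add (k := k) H B' x
    have h2 := hdeg x
    rw [card_filter_inl_mem hH, hpascal, Nat.cast_add] at h2
    linarith
  have hM : ((∑ x, (P \ link k H x).card : ℕ) : ℝ) ≤ (t - A.toLeft.card) * P.card +
      A.toLeft.card * ((n - t).choose j + a₃ * n ^ k) + S := by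
    rw [hsplit, Nat.cast_add]
    have h1 : ((∑ x ∈ A.toLeft, (P \ link k H x).card : ℕ) : ℝ) ≤
        A.toLeft.card * ((n - t).choose j + a₃ * n ^ k) + S := by
      rw [Nat.cast_sum]
      refine (Finset.sum_le_sum fun x _ => hmiss x).trans (le_of_eq ?_)
      rw [Finset.sum_add_distrib, Finset.sum_const, nsmul_eq_mul, hSdef, Nat.cast_sum]
    have h2 : ((∑ x ∈ A.toLeftᶜ, (P \ link k H x).card : ℕ) : ℝ) ≤
        (t - A.toLeft.card) * P.card := by
      rw [← hcomplR]
      have : ∑ x ∈ A.toLeftᶜ, (P \ link k H x).card ≤ (A.toLeftᶜ).card * P.card := by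
        simpa using Finset.sum_le_card_nsmul A.toLeftᶜ _ _ fun x _ =>
          Finset.card_le_card (Finset.sdiff_subset : P \ link k H x ⊆ P)
      exact_mod_cast this
    linarith
  have hσR : ((FtEdges n k t \ H.image fun e => e.image σ).card : ℝ) ≤
      ((∑ x, (P \ link k H x).card : ℕ) : ℝ) := by exact_mod_cast hσ
  exact hσR.trans (missing_le hkR hε hε' htR hp (by exact_mod_cast hpt) hCpos hD hh hh' hS hZ
    (by positivity) hM)
end

section
/- For every integer k ≥ 3 there exists ε₀ > 0 such that for every real ε with 0 < ε < ε₀ there exist c₀ > 0 and n₀ such that the following holds for every real c with 0 < c < c₀ and all integers n ≥ n₀ with k | n and t with n/(3k²) ≤ t ≤ n/(2k). Let H be a balanced (1,k)-partite (k+1)-graph with partition classes X = {x_1, …, x_{n/k}} and [n], and set X' = {x_1, …, x_t}. Suppose d_H(x) ≥ C(n,k) − C(n−t+1,k) − √c·n^k for every x ∈ X', d_H(x) = C(n,k) for every x ∈ X ∖ X', and every set S ⊆ V(H) containing no edge of H satisfies |S ∩ X| ≤ (t/n − ε)·n or |S ∩ [n]| ≤ (1 − t/n − ε)·n. Then H has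 a fractional perfect matching. -/
/-- A finite hypergraph without a fractional matching of total weight `m` has a fractional vertex
cover of total weight less than `m`. -/
lemma exists_fractional_cover_of_not_exists_fractional_matching {V : Type*} [Fintype V]
    [DecidableEq V] (H : Finset (Finset V)) (hH : ∀ e ∈ H, e.Nonempty)
    (m : ℝ) (hm : 0 < m)
    (hno : ¬ ∃ h : Finset V → ℝ, (∀ e, 0 ≤ h e ∧ h e ≤ 1) ∧ (∀ e ∉ H, h e = 0) ∧
      (∀ v, ∑ e ∈ H.filter fun e => v ∈ e, h e ≤ 1) ∧ ∑ e ∈ H, h e = m) :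
    ∃ w : V → ℝ, (∀ v, 0 ≤ w v) ∧ (∀ e ∈ H, 1 ≤ ∑ v ∈ e, w v) ∧ ∑ v, w v < m := by
  classical
  let L : (H → ℝ) →ₗ[ℝ] (V → ℝ) := LinearMap.pi fun v =>
    ∑ e : H, (if v ∈ e.1 then m else 0) • LinearMap.proj e
  have hL : ∀ h v, L h v = ∑ e : H, (if v ∈ e.1 then m else 0) * h e := by
    intro h v
    simp only [L, LinearMap.pi_apply, LinearMap.sum_apply, LinearMap.smul_apply,
      LinearMap.proj_apply, smul_eq_mul]
  let K : Set (V → ℝ) := L '' stdSimplex ℝ H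
  let D : Set (V → ℝ) := {y | ∀ v, y v ≤ 1}
  have hKc : Convex ℝ K := (convex_stdSimplex ℝ H).linear_image L
  have hKk : IsCompact K := (isCompact_stdSimplex ℝ H).image L.continuous_of_finiteDimensional
  have hDc : Convex ℝ D := by
    intro x hx y hy a b ha hb hab v
    simp only [Pi.add_apply, Pi.smul_apply, smul_eq_mul]
    nlinarith [hx v, hy v]
  have hDk : IsClosed D := by
    simp only [D, Set.ofPred_forall]
    exact isClosed_iInter fun v => isClosed_le (continuous_apply v) continuous_const
  have hdisj : Disjoint K D := by
    rw [Set.disjoint_left]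
    rintro _ ⟨h, ⟨h0, h1⟩, rfl⟩ hD
    refine hno ⟨fun e => if he : e ∈ H then m * h ⟨e, he⟩ else 0, ?_⟩
    have hv : ∀ v, ∑ e ∈ H.filter (fun e => v ∈ e),
        (if he : e ∈ H then m * h ⟨e, he⟩ else 0) ≤ 1 := by
      intro v
      have := hD v
      rw [hL] at this
      rw [Finset.sum_filter, ← Finset.sum_coe_sort H]
      refine le_trans (le_of_eq (Finset.sum_congr rfl fun e _ => ?_)) this
      simp
    have hn : ∀ e, 0 ≤ (if he : e ∈ H then m * h ⟨e, he⟩ else 0) := by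
      intro e
      split_ifs with he
      · exact mul_nonneg hm.le (h0 _)
      · exact le_rfl
    refine ⟨fun e => ⟨hn e, ?_⟩, fun e he => by simp [he], hv, ?_⟩
    · by_cases he : e ∈ H
      · obtain ⟨v, hve⟩ := hH e he
        exact (Finset.single_le_sum (f := fun e => if he : e ∈ H then m * h ⟨e, he⟩ else 0)
          (fun e _ => hn e) (by simp [he, hve] : e ∈ H.filter fun e => v ∈ e)).trans (hv v)
      · simp [he]
    · rw [← Finset.sum_coe_sort H]
      simp only [Finset.coe_mem, dite_true, Subtype.coe_eta, ← Finset.mul_sum, h1, mul_one]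
  obtain ⟨f, u, v, hf, huv, hg⟩ := geometric_hahn_banach_compact_closed hKc hKk hDc hDk hdisj
  have hfs : ∀ y : V → ℝ, f y = ∑ i, y i * f (Pi.single i 1) := by
    intro y
    have := LinearMap.pi_apply_eq_sum_univ (f : (V → ℝ) →ₗ[ℝ] ℝ) y
    refine this.trans (Finset.sum_congr rfl fun i _ => ?_)
    rw [ContinuousLinearMap.coe_coe, smul_eq_mul]
    congr 2
    ext j
    simp only [Pi.single_apply, eq_comm]
  set w : V → ℝ := fun i => - f (Pi.single i 1) with hw
  have hw0 : ∀ i, 0 ≤ w i := by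
    intro i
    by_contra hneg
    simp only [hw, not_le, neg_lt_zero] at hneg
    have hmem : ((-(|v| / f (Pi.single i 1))) • (Pi.single i 1 : V → ℝ)) ∈ D := by
      intro j
      have : 0 ≤ |v| / f (Pi.single i 1) := by positivity
      by_cases hj : j = i
      · subst hj
        simp
        linarith
      · simp [hj]
    have := hg _ hmem
    rw [map_smul, smul_eq_mul, neg_mul, div_mul_cancel₀ _ hneg.ne'] at this
    linarith [hg 0 (fun j => by simp), neg_abs_le v, map_zero f]
  have hone : ∑ i, w i < - v := by
    have := hg 1 (fun j => le_rfl)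
    rw [hfs] at this
    simp only [Pi.one_apply, one_mul] at this
    simp only [hw, Finset.sum_neg_distrib]
    linarith
  have hedge : ∀ e ∈ H, -u < m * ∑ i ∈ e, w i := by
    intro e he
    have := hf (L (Pi.single ⟨e, he⟩ 1)) ⟨_, single_mem_stdSimplex ℝ _, rfl⟩
    rw [hfs] at this
    have h2 : ∀ i, L (Pi.single ⟨e, he⟩ 1) i = if i ∈ e then m else 0 := by
      intro i
      rw [hL, Finset.sum_eq_single ⟨e, he⟩]
      · simp
      · intro b _ hb
        simp [hb]
      · simp
    simp only [h2, ite_mul, zero_mul, Finset.sum_ite_mem, Finset.univ_inter] at this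
    rw [← Finset.mul_sum] at this
    simp only [hw, Finset.sum_neg_distrib]
    linarith
  have hwn : 0 ≤ ∑ i, w i := Finset.sum_nonneg fun i _ => hw0 i
  have hu : 0 < -u := by linarith
  refine ⟨fun i => m / (-u) * w i, fun i => mul_nonneg (by positivity) (hw0 i), ?_, ?_⟩
  · intro e he
    rw [← Finset.mul_sum, div_mul_eq_mul_div, le_div_iff₀ hu]
    linarith [hedge e he]
  · rw [← Finset.mul_sum, div_mul_eq_mul_div, div_lt_iff₀ hu]
    nlinarith

lemma exists_top_subset {V : Type*} [DecidableEq V] (U : Finset V) (b : V → ℝ) (j : ℕ)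
    (hj : j ≤ U.card) :
    ∃ T ⊆ U, T.card = j ∧ ∀ u ∈ T, ∀ v ∈ U \ T, b v ≤ b u := by
  induction j with
  | zero => exact ⟨∅, by simp⟩
  | succ j ih =>
    obtain ⟨T, hTU, hT, hb⟩ := ih (by omega)
    have hne : (U \ T).Nonempty := by
      rw [← Finset.card_pos, Finset.card_sdiff_of_subset hTU]
      omega
    obtain ⟨x, hx, hmax⟩ := Finset.exists_max_image (U \ T) b hne
    have hx' := Finset.mem_sdiff.1 hx
    refine ⟨insert x T, Finset.insert_subset hx'.1 hTU, by
      rw [Finset.card_insert_of_notMem hx'.2, hT], ?_⟩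
    intro u hu v hv
    simp only [Finset.mem_sdiff, Finset.mem_insert, not_or] at hv
    have hvUT : v ∈ U \ T := Finset.mem_sdiff.2 ⟨hv.1, hv.2.2⟩
    rcases Finset.mem_insert.1 hu with rfl | hu
    · exact hmax v hvUT
    · exact hb u hu v hvUT

/-- The average of `∑ v ∈ R, b v` over the `j`-subsets `R` of `Y`. -/
lemma card_mul_sum_powersetCard_sum {V : Type*} [DecidableEq V] (Y : Finset V) (b : V → ℝ)
    (j : ℕ) :
    (Y.card : ℝ) * ∑ R ∈ Y.powersetCard j, ∑ v ∈ R, b v =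
      j * Y.card.choose j * ∑ v ∈ Y, b v := by
  obtain _ | j := j
  · simp
  have hcard : ∀ v ∈ Y, ((Y.powersetCard (j + 1)).filter fun R => v ∈ R).card =
      (Y.card - 1).choose j := by
    intro v hv
    simpa using Finset.card_filter_powersetCard_subset {v} Y (j + 1) (by simpa using hv) (by simp)
  have h1 : ∑ R ∈ Y.powersetCard (j + 1), ∑ v ∈ R, b v =
      ((Y.card - 1).choose j : ℝ) * ∑ v ∈ Y, b v := by
    rw [Finset.mul_sum, Finset.sum_comm' (t' := Y)
      (s' := fun v => (Y.powersetCard (j + 1)).filter fun R => v ∈ R)]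
    · refine Finset.sum_congr rfl fun v hv => ?_
      rw [Finset.sum_const, hcard v hv, nsmul_eq_mul]
    · intro R v
      simp only [Finset.mem_powersetCard, Finset.mem_filter]
      exact ⟨fun h => ⟨⟨h.1, h.2⟩, h.1.1 h.2⟩, fun h => h.1⟩
  rw [h1]
  rcases Nat.eq_zero_or_pos Y.card with h0 | h0
  · simp [Finset.card_eq_zero.1 h0]
  · obtain ⟨N, hN⟩ := Nat.exists_eq_succ_of_ne_zero h0.ne'
    have := Nat.add_one_mul_choose_eq N j
    rw [hN]
    simp only [Nat.succ_eq_add_one, Nat.add_sub_cancel]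
    have h2 : ((N + 1 : ℕ) : ℝ) * N.choose j = (N + 1).choose (j + 1) * (j + 1 : ℕ) := by
      exact_mod_cast this
    linear_combination (∑ v ∈ Y, b v) * h2

/-- A Markov-type inequality for a nonnegative random variable `B`, uniform on `Ω`, with mean
less than `(∑ u ∈ T, c u) / q`: the expected number of thresholds `c u` it exceeds, with an extra
weight `q - |T|` on exceeding the upper bound `C` of all thresholds, is at most `|T|`. -/
lemma sum_card_threshold_le {Ω V : Type*} (P : Finset Ω) (B : Ω → ℝ)
    (hB : ∀ ω ∈ P, 0 ≤ B ω) (T : Finset V) (c : V → ℝ) (C q : ℝ) (hcC : ∀ u ∈ T, c u ≤ C)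
    (hq : (T.card : ℝ) < q) (hmean : q * ∑ ω ∈ P, B ω < P.card * ∑ u ∈ T, c u) :
    ∑ ω ∈ P, ((T.filter fun u => c u ≤ B ω).card : ℝ) +
      (q - T.card) * (P.filter fun ω => C ≤ B ω).card ≤ T.card * P.card := by
  classical
  have hq0 : 0 < q := lt_of_le_of_lt (Nat.cast_nonneg _) hq
  have hBs : 0 ≤ ∑ ω ∈ P, B ω := Finset.sum_nonneg hB
  have hP : 0 < (P.card : ℝ) := by
    rcases P.eq_empty_or_nonempty with rfl | h
    · simp at hmean
    · exact_mod_cast h.card_pos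
  have hcs : ∑ u ∈ T, c u ≤ T.card * C := by
    simpa using Finset.sum_le_card_nsmul T c C hcC
  have hNT : ∀ r : ℝ, ((T.filter fun u => c u ≤ r).card : ℝ) ≤ T.card := fun r => by
    exact_mod_cast Finset.card_filter_le _ _
  rcases (P.filter fun ω => B ω < C).eq_empty_or_nonempty with hempty | hne
  · exfalso
    have h1 : ∀ ω ∈ P, C ≤ B ω := by
      intro ω hω
      by_contra hlt
      have : ω ∈ P.filter fun ω => B ω < C := Finset.mem_filter.2 ⟨hω, not_le.1 hlt⟩
      simp [hempty] at this
    have h2 : P.card * C ≤ ∑ ω ∈ P, B ω := by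
      simpa using Finset.card_nsmul_le_sum P B C h1
    have hC : 0 < C := by
      by_contra hC
      nlinarith [mul_nonneg hq0.le hBs, mul_nonneg (Nat.cast_nonneg (α := ℝ) T.card)
        (neg_nonneg.2 (not_lt.1 hC))]
    have h3 : q * (P.card * C) ≤ q * ∑ ω ∈ P, B ω := by gcongr
    have h4 : (P.card : ℝ) * ∑ u ∈ T, c u ≤ P.card * (T.card * C) := by gcongr
    nlinarith [mul_pos hP hC]
  · obtain ⟨ω₀, hω₀, hmin⟩ := Finset.exists_min_image _
      (fun ω => (q - (T.filter fun u => c u ≤ B ω).card) / (C - B ω)) hne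
    obtain ⟨hω₀P, hω₀C⟩ := Finset.mem_filter.1 hω₀
    set N : ℝ := ((T.filter fun u => c u ≤ B ω₀).card : ℝ) with hN
    set r := B ω₀ with hr
    have hr0 : 0 ≤ r := hB _ hω₀P
    set y := (q - N) / (C - r) with hy
    have hNq : N ≤ T.card := hNT r
    have hCr : 0 < C - r := by linarith
    have hy0 : 0 ≤ y := div_nonneg (by linarith) hCr.le
    have hyN : y * (C - r) = q - N := div_mul_cancel₀ _ hCr.ne'
    have hpt : ∀ ω ∈ P, ((T.filter fun u => c u ≤ B ω).card : ℝ) +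
        (q - T.card) * (if C ≤ B ω then 1 else 0) ≤ q - y * (C - B ω) := by
      intro ω hω
      split_ifs with h
      · nlinarith [hNT (B ω)]
      · have hlt := not_le.1 h
        have := hmin ω (Finset.mem_filter.2 ⟨hω, hlt⟩)
        rw [le_div_iff₀ (by linarith)] at this
        linarith
    have hsum := Finset.sum_le_sum hpt
    rw [Finset.sum_add_distrib, ← Finset.mul_sum, Finset.sum_boole, Finset.sum_sub_distrib,
      ← Finset.mul_sum, Finset.sum_sub_distrib] at hsum
    simp only [Finset.sum_const, nsmul_eq_mul] at hsum
    refine hsum.trans ?_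
    have hcN : ∑ u ∈ T, c u ≤ N * r + (T.card - N) * C := by
      have h1 : ∑ u ∈ T, c u ≤ ∑ u ∈ T, (C + (if c u ≤ r then (r - C) else 0)) := by
        refine Finset.sum_le_sum fun u hu => ?_
        split_ifs with h
        · linarith
        · linarith [hcC u hu]
      rw [Finset.sum_add_distrib, ← Finset.sum_filter] at h1
      simp only [Finset.sum_const, nsmul_eq_mul] at h1
      rw [← hN] at h1
      linarith
    have hN0 : 0 ≤ N := Nat.cast_nonneg _
    set m := ∑ ω ∈ P, B ω
    -- the mean satisfies `q (m / |P| - r) ≤ (|T| - N) (C - r)`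
    have h5 : q * (m - P.card * r) ≤ P.card * ((T.card - N) * (C - r)) := by
      have : (P.card : ℝ) * ∑ u ∈ T, c u ≤ P.card * (N * r + (T.card - N) * C) := by gcongr
      nlinarith [mul_nonneg hP.le (mul_nonneg (sub_nonneg.2 hq.le) hr0)]
    have h6 : y * (q * (m - P.card * r)) ≤ P.card * ((T.card - N) * (q - N)) := by
      calc y * (q * (m - P.card * r)) ≤ y * (P.card * ((T.card - N) * (C - r))) := by gcongr
        _ = P.card * ((T.card - N) * (y * (C - r))) := by ring
        _ = _ := by rw [hyN]
    have h7 : y * (m - P.card * r) ≤ P.card * (T.card - N) := by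
      refine le_of_mul_le_mul_left ?_ hq0
      nlinarith [mul_nonneg hP.le (mul_nonneg (sub_nonneg.2 hNq) hN0)]
    have h8 : (P.card : ℝ) * (y * (C - r)) = P.card * (q - N) := by rw [hyN]
    nlinarith

/-- If `b` has total weight at most `s θ` on `Y` then the family of `(j+1)`-sets of weight at
least `θ` is at most `s` times as large as any threshold family containing its shadow. -/
lemma card_heavy_le_mul_card_heavy_shadow {V : Type*} [DecidableEq V] (Y : Finset V) (b : V → ℝ)
    (j : ℕ) (θ C s : ℝ) (hθ : 0 < θ) (hb : ∀ y ∈ Y, 0 ≤ b y) (hbC : ∀ y ∈ Y, b y ≤ θ - C)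
    (hs : ∑ y ∈ Y, b y ≤ s * θ) :
    (((Y.powersetCard (j + 1)).filter fun S => θ ≤ ∑ v ∈ S, b v).card : ℝ) ≤
      s * ((Y.powersetCard j).filter fun R => C ≤ ∑ v ∈ R, b v).card := by
  set F := (Y.powersetCard (j + 1)).filter fun S => θ ≤ ∑ v ∈ S, b v with hF
  set G := (Y.powersetCard j).filter fun R => C ≤ ∑ v ∈ R, b v with hG
  have h1 : F.card * θ ≤ ∑ S ∈ F, ∑ v ∈ S, b v := by
    simpa using Finset.card_nsmul_le_sum F (fun S => ∑ v ∈ S, b v) θ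
      fun S hS => (Finset.mem_filter.1 hS).2
  have h2 : ∑ S ∈ F, ∑ v ∈ S, b v ≤ ∑ R ∈ G, ∑ v ∈ Y, b v := by
    rw [Finset.sum_sigma', ← Finset.sum_product' G Y (fun _ v => b v)]
    have hmem : ∀ p ∈ F.sigma fun S => S, p.2 ∈ p.1 ∧ p.1 ⊆ Y ∧
        (p.1.erase p.2, p.2) ∈ G ×ˢ Y := by
      rintro ⟨S, v⟩ hp
      simp only [Finset.mem_sigma, hF, Finset.mem_filter, Finset.mem_powersetCard] at hp
      obtain ⟨⟨⟨hSY, hSc⟩, hSθ⟩, hvS⟩ := hp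
      refine ⟨hvS, hSY, ?_⟩
      simp only [Finset.mem_product, hG, Finset.mem_filter, Finset.mem_powersetCard]
      refine ⟨⟨⟨(Finset.erase_subset _ _).trans hSY, ?_⟩, ?_⟩, hSY hvS⟩
      · rw [Finset.card_erase_of_mem hvS, hSc]
        rfl
      · have := Finset.add_sum_erase S b hvS
        linarith [hbC v (hSY hvS)]
    rw [← Finset.sum_image (f := fun p : Finset V × V => b p.2)
      (g := fun p : (_ : Finset V) × V => (p.1.erase p.2, p.2))]
    · refine Finset.sum_le_sum_of_subset_of_nonneg ?_ ?_
      · intro x hx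
        obtain ⟨p, hp, rfl⟩ := Finset.mem_image.1 hx
        exact (hmem p hp).2.2
      · intro x hx _
        exact hb _ (Finset.mem_product.1 hx).2
    · rintro ⟨S, v⟩ hp ⟨S', v'⟩ hp' h
      simp only [Prod.mk.injEq] at h
      obtain ⟨h, rfl⟩ := h
      have e1 := Finset.insert_erase (hmem _ hp).1
      have e2 := Finset.insert_erase (hmem _ hp').1
      simp only at e1 e2
      rw [← e1, h, e2]
  rw [Finset.sum_const, nsmul_eq_mul] at h2
  refine le_of_mul_le_mul_right ?_ hθ
  calc F.card * θ ≤ G.card * ∑ v ∈ Y, b v := h1.trans h2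
    _ ≤ G.card * (s * θ) := by gcongr
    _ = _ := by ring

/-- The light `(j+1)`-subsets of `U` meeting `T` in at most one vertex. -/
lemma sum_card_light_add_card_light_le {V : Type*} [DecidableEq V] (U T : Finset V) (hTU : T ⊆ U)
    (b : V → ℝ) (j : ℕ) (θ : ℝ) :
    ∑ u ∈ T, (((U \ T).powersetCard j).filter fun R => b u + ∑ v ∈ R, b v < θ).card +
      (((U \ T).powersetCard (j + 1)).filter fun S => ∑ v ∈ S, b v < θ).card ≤
      ((U.powersetCard (j + 1)).filter fun S => ∑ v ∈ S, b v < θ).card := by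
  let A : V → Finset (Finset V) := fun u =>
    (((U \ T).powersetCard j).filter fun R => b u + ∑ v ∈ R, b v < θ).image (insert u)
  have hnot : ∀ u ∈ T, ∀ R ⊆ U \ T, u ∉ R := fun u hu R hR huR =>
    (Finset.mem_sdiff.1 (hR huR)).2 hu
  have hA : ∀ u ∈ T, (A u).card =
      (((U \ T).powersetCard j).filter fun R => b u + ∑ v ∈ R, b v < θ).card := by
    intro u hu
    refine Finset.card_image_of_injOn fun R hR R' hR' h => ?_
    simp only [Finset.coe_filter, Finset.mem_powersetCard, Set.mem_ofPred_eq] at hR hR'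
    rw [← Finset.erase_insert (hnot u hu R hR.1.1), h,
      Finset.erase_insert (hnot u hu R' hR'.1.1)]
  have hmemA : ∀ u ∈ T, ∀ S ∈ A u, S ∩ T = {u} ∧ S ⊆ U ∧ S.card = j + 1 ∧ ∑ v ∈ S, b v < θ := by
    intro u hu S hS
    obtain ⟨R, hR, rfl⟩ := Finset.mem_image.1 hS
    simp only [Finset.mem_filter, Finset.mem_powersetCard] at hR
    have huR := hnot u hu R hR.1.1
    refine ⟨?_, ?_, by rw [Finset.card_insert_of_notMem huR, hR.1.2], by
      rw [Finset.sum_insert huR]; exact hR.2⟩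
    · have hd : R ∩ T = ∅ := Finset.disjoint_iff_inter_eq_empty.1
        (Finset.disjoint_of_subset_left hR.1.1 Finset.sdiff_disjoint)
      rw [Finset.insert_inter_of_mem hu, hd]
      rfl
    · exact Finset.insert_subset (hTU hu) (hR.1.1.trans Finset.sdiff_subset)
  rw [← Finset.sum_congr rfl hA, ← Finset.card_biUnion, ← Finset.card_union_of_disjoint]
  · refine Finset.card_le_card (Finset.union_subset ?_ ?_)
    · refine Finset.biUnion_subset.2 fun u hu S hS => ?_
      obtain ⟨-, h1, h2, h3⟩ := hmemA u hu S hS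
      exact Finset.mem_filter.2 ⟨Finset.mem_powersetCard.2 ⟨h1, h2⟩, h3⟩
    · exact Finset.filter_subset_filter _ (Finset.powersetCard_mono Finset.sdiff_subset)
  · rw [Finset.disjoint_left]
    intro S hS hS'
    obtain ⟨u, hu, hSu⟩ := Finset.mem_biUnion.1 hS
    have h1 : u ∈ S ∩ T := by simp [(hmemA u hu S hSu).1]
    have h2 := (Finset.mem_powersetCard.1 (Finset.mem_filter.1 hS').1).1
    exact hnot u hu S h2 (Finset.mem_inter.1 h1).1
  · intro u hu u' hu' huu'
    rw [Function.onFun, Finset.disjoint_left]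
    intro S hS hS'
    have h1 := (hmemA u hu S hS).1
    rw [(hmemA u' hu' S hS').1] at h1
    exact huu' (Finset.singleton_injective h1).symm

/-- Stability for threshold families of sets with small fractional matching number: if the number
of light `(j+1)`-sets is close to the minimum possible, then almost all `(j+1)`-sets meeting the
set `T` of heaviest vertices in exactly one vertex are heavy. -/
lemma light_stars_le {V : Type*} [DecidableEq V] (U T : Finset V) (hTU : T ⊆ U) (b : V → ℝ)
    (j : ℕ) (hj : 0 < j) (θ q E : ℝ) (hT : T.Nonempty) (hθ : 0 < θ) (hb : ∀ v ∈ U, 0 ≤ b v)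
    (htop : ∀ u ∈ T, ∀ v ∈ U \ T, b v ≤ b u) (hsum : ∑ v ∈ U, b v < T.card * θ)
    (hq : q * j = (U \ T).card) (htq : 2 * (T.card : ℝ) < q) (hjN : j ≤ (U \ T).card)
    (hE : (((U.powersetCard (j + 1)).filter fun S => ∑ v ∈ S, b v < θ).card : ℝ) ≤
      ((U \ T).card.choose (j + 1) : ℝ) + E) :
    (q - 2 * T.card) *
      ∑ u ∈ T, ((((U \ T).powersetCard j).filter fun R => b u + ∑ v ∈ R, b v < θ).card : ℝ) ≤
      (q - T.card) * E := by
  set Y := U \ T with hY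
  have hYU : Y ⊆ U := Finset.sdiff_subset
  obtain ⟨u₀, hu₀, hmin⟩ := Finset.exists_min_image T b hT
  set C := θ - b u₀ with hC
  set D := ∑ u ∈ T, (((Y.powersetCard j).filter fun R => b u + ∑ v ∈ R, b v < θ).card : ℝ) with hD
  set g : ℝ := (((Y.powersetCard j).filter fun R => C ≤ ∑ v ∈ R, b v).card : ℝ) with hg
  have hj' : (0 : ℝ) < j := by exact_mod_cast hj
  have hT0 : (0 : ℝ) < T.card := by exact_mod_cast hT.card_pos
  have hsplit : ∑ v ∈ Y, b v + ∑ v ∈ T, b v = ∑ v ∈ U, b v := Finset.sum_sdiff hTU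
  have hbT : 0 ≤ ∑ v ∈ T, b v := Finset.sum_nonneg fun v hv => hb v (hTU hv)
  have hshadow : (((Y.powersetCard (j + 1)).filter fun S => θ ≤ ∑ v ∈ S, b v).card : ℝ) ≤
      T.card * g :=
    card_heavy_le_mul_card_heavy_shadow Y b j θ C T.card hθ (fun y hy => hb y (hYU hy))
      (fun y hy => by simpa [hC] using htop u₀ hu₀ y hy) (by linarith)
  have hmean := card_mul_sum_powersetCard_sum Y b j
  have hM : 0 < (Y.card.choose j : ℝ) := by exact_mod_cast Nat.choose_pos hjN
  have hA := sum_card_threshold_le (Y.powersetCard j) (fun R => ∑ v ∈ R, b v)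
    (fun R hR => Finset.sum_nonneg fun v hv =>
      hb v (hYU ((Finset.mem_powersetCard.1 hR).1 hv))) T (fun u => θ - b u) C q
    (fun u hu => by linarith [hmin u hu]) (by linarith) (by
      rw [Finset.card_powersetCard, Finset.sum_sub_distrib, Finset.sum_const, nsmul_eq_mul]
      rw [← hq] at hmean
      have h1 : q * ∑ R ∈ Y.powersetCard j, ∑ v ∈ R, b v = Y.card.choose j * ∑ v ∈ Y, b v := by
        refine mul_left_cancel₀ hj'.ne' ?_
        linarith
      rw [h1]
      refine mul_lt_mul_of_pos_left ?_ hM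
      linarith)
  rw [← hg, Finset.card_powersetCard] at hA
  have hswap : ∑ R ∈ Y.powersetCard j, ((T.filter fun u => θ - b u ≤ ∑ v ∈ R, b v).card : ℝ) =
      T.card * Y.card.choose j - D := by
    have h1 : ∀ R ∈ Y.powersetCard j,
        ((T.filter fun u => θ - b u ≤ ∑ v ∈ R, b v).card : ℝ) =
        T.card - ∑ u ∈ T, if b u + ∑ v ∈ R, b v < θ then (1 : ℝ) else 0 := by
      intro R _
      rw [Finset.sum_boole, eq_sub_iff_add_eq,
        ← Finset.card_filter_add_card_filter_not (s := T) (fun u => θ - b u ≤ ∑ v ∈ R, b v)]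
      push_cast
      congr 3
      refine Finset.filter_congr fun u _ => ?_
      rw [not_le, lt_sub_iff_add_lt']
    rw [Finset.sum_congr rfl h1, Finset.sum_sub_distrib, Finset.sum_comm, hD]
    simp only [Finset.sum_const, Finset.card_powersetCard, nsmul_eq_mul, Finset.sum_boole]
    ring
  rw [hswap] at hA
  have hcount := sum_card_light_add_card_light_le U T hTU b j θ
  rw [← hY] at hcount
  have hcount' : D + (((Y.powersetCard (j + 1)).filter fun S => ∑ v ∈ S, b v < θ).card : ℝ) ≤
      (((U.powersetCard (j + 1)).filter fun S => ∑ v ∈ S, b v < θ).card : ℝ) := by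
    rw [hD]
    exact_mod_cast hcount
  have hcompl : (((Y.powersetCard (j + 1)).filter fun S => θ ≤ ∑ v ∈ S, b v).card : ℝ) +
      (((Y.powersetCard (j + 1)).filter fun S => ∑ v ∈ S, b v < θ).card : ℝ) =
      Y.card.choose (j + 1) := by
    have := Finset.card_filter_add_card_filter_not (s := Y.powersetCard (j + 1))
      (fun S => θ ≤ ∑ v ∈ S, b v)
    simp only [not_le, Finset.card_powersetCard] at this
    exact_mod_cast this
  have hDE : D ≤ E + T.card * g := by linarith
  have hgD : (q - T.card) * g ≤ D := by linarith
  have hqT : 0 ≤ q - T.card := by linarith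
  nlinarith [mul_le_mul_of_nonneg_left hDE hqT, mul_le_mul_of_nonneg_left hgD hT0.le]

/-- Lower bound for the total weight in terms of the number of light stars, for stars avoiding
a set `Z` of moderately heavy vertices. -/
lemma weight_lower_bound {V : Type*} [DecidableEq V] (U T Z : Finset V) (hTU : T ⊆ U)
    (hZU : Z ⊆ U \ T) (b : V → ℝ) (j : ℕ) (θ β : ℝ) (hθ : 0 < θ)
    (hb : ∀ v ∈ U, 0 ≤ b v) (hZ : ∀ v ∈ Z, β ≤ b v)
    (hpos : 0 < ((U \ T) \ Z).card) (hjt : T.card * j ≤ ((U \ T) \ Z).card) :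
    ((T.card : ℝ) * (((U \ T) \ Z).card.choose j) -
      ∑ u ∈ T, ((((U \ T).powersetCard j).filter fun R => b u + ∑ v ∈ R, b v < θ).card : ℝ)) * θ +
      (((U \ T) \ Z).card.choose j) * (Z.card * β) ≤
      (((U \ T) \ Z).card.choose j) * ∑ v ∈ U, b v := by
  set Y := (U \ T) \ Z with hY
  have hYU : Y ⊆ U := Finset.sdiff_subset.trans Finset.sdiff_subset
  set M : ℝ := (Y.card.choose j : ℝ) with hM
  have hM0 : 0 ≤ M := Nat.cast_nonneg _
  have h1 : ∑ v ∈ Y, b v + ∑ v ∈ Z, b v + ∑ v ∈ T, b v = ∑ v ∈ U, b v := by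
    rw [← Finset.sum_sdiff hTU, ← Finset.sum_sdiff hZU]
  have h2 : Z.card * β ≤ ∑ v ∈ Z, b v := by
    simpa using Finset.card_nsmul_le_sum Z b β hZ
  have hmean := card_mul_sum_powersetCard_sum Y b j
  rw [← hM] at hmean
  set m := ∑ R ∈ Y.powersetCard j, ∑ v ∈ R, b v with hm
  have hbY : 0 ≤ ∑ v ∈ Y, b v := Finset.sum_nonneg fun v hv => hb v (hYU hv)
  have hYpos : (0 : ℝ) < Y.card := by exact_mod_cast hpos
  have hTm : T.card * m ≤ M * ∑ v ∈ Y, b v := by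
    refine le_of_mul_le_mul_left ?_ hYpos
    have : (T.card : ℝ) * j ≤ Y.card := by exact_mod_cast hjt
    nlinarith [mul_nonneg hM0 hbY]
  have h3 : ∀ u ∈ T, (M - (((U \ T).powersetCard j).filter fun R =>
      b u + ∑ v ∈ R, b v < θ).card) * θ ≤ M * b u + m := by
    intro u hu
    have h4 : ∀ R ∈ Y.powersetCard j,
        (1 - (if b u + ∑ v ∈ R, b v < θ then (1 : ℝ) else 0)) * θ ≤ b u + ∑ v ∈ R, b v := by
      intro R hR
      split_ifs with h
      · have : 0 ≤ ∑ v ∈ R, b v := Finset.sum_nonneg fun v hv =>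
          hb v (hYU ((Finset.mem_powersetCard.1 hR).1 hv))
        linarith [hb u (hTU hu)]
      · linarith
    have h5 := Finset.sum_le_sum h4
    rw [← Finset.sum_mul, Finset.sum_sub_distrib, Finset.sum_add_distrib, ← hm,
      Finset.sum_boole] at h5
    simp only [Finset.sum_const, Finset.card_powersetCard, nsmul_eq_mul, mul_one, ← hM] at h5
    refine le_trans ?_ h5
    have h6 : ((Y.powersetCard j).filter fun R => b u + ∑ v ∈ R, b v < θ).card ≤
        (((U \ T).powersetCard j).filter fun R => b u + ∑ v ∈ R, b v < θ).card :=
      Finset.card_le_card (Finset.filter_subset_filter _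
        (Finset.powersetCard_mono Finset.sdiff_subset))
    have h7 : (((Y.powersetCard j).filter fun R => b u + ∑ v ∈ R, b v < θ).card : ℝ) ≤
        (((U \ T).powersetCard j).filter fun R => b u + ∑ v ∈ R, b v < θ).card := by
      exact_mod_cast h6
    gcongr
  have h8 := Finset.sum_le_sum h3
  rw [← Finset.sum_mul, Finset.sum_sub_distrib, Finset.sum_add_distrib, ← Finset.mul_sum] at h8
  simp only [Finset.sum_const, nsmul_eq_mul] at h8
  rw [← h1]
  nlinarith [mul_le_mul_of_nonneg_left h2 hM0]

/-- There is no fractional cover of total weight less than `t` for `t` families which are almost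
as large as the stars of `t` vertices and which do not leave an almost extremal independent
set. -/
lemma weight_not_lt {ι V : Type*} [DecidableEq ι] [DecidableEq V] (A : Finset ι) (a : ι → ℝ)
    (U : Finset V) (b : V → ℝ) (j t z : ℕ) (q E : ℝ) (hj : 0 < j) (ht : 0 < t) (hz : 0 < z)
    (hzt : z ≤ t) (hA : A.card = t) (hb : ∀ v ∈ U, 0 ≤ b v)
    (hdeg : ∀ i ∈ A, (((U.powersetCard (j + 1)).filter fun S => a i + ∑ v ∈ S, b v < 1).card : ℝ) ≤
      ((U.card - t).choose (j + 1) : ℝ) + E)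
    (hind : ∀ A' ⊆ A, ∀ W ⊆ U, A'.card + z = t → W.card + t + z = U.card →
      ∀ β : ℝ, (∀ v ∈ W, b v ≤ β) → ∃ i ∈ A', 1 ≤ a i + (j + 1) * β)
    (hU : t * j + t + z ≤ U.card) (hq : q * j = U.card - t) (htq : 2 * (t : ℝ) < q)
    (hnum : (j + 1) * ((q - t) * E) ≤ z * ((U.card - t - z).choose j) * (q - 2 * t)) :
    (t : ℝ) ≤ ∑ i ∈ A, a i + ∑ v ∈ U, b v := by
  by_contra! hsum
  have hbU : 0 ≤ ∑ v ∈ U, b v := Finset.sum_nonneg hb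
  have ht' : (0 : ℝ) < t := by exact_mod_cast ht
  have hz' : (0 : ℝ) < z := by exact_mod_cast hz
  obtain ⟨i₀, hi₀, hmin⟩ := Finset.exists_min_image A a (by rw [← Finset.card_pos]; omega)
  have haA : t * a i₀ ≤ ∑ i ∈ A, a i := by
    simpa [hA] using Finset.card_nsmul_le_sum A a (a i₀) hmin
  set θ := 1 - a i₀ with hθdef
  have hθ : 0 < θ := by
    by_contra hneg
    nlinarith
  obtain ⟨AT, hATA, hATc, hAT⟩ := exists_top_subset A a z (by omega)
  obtain ⟨T, hTU, hTc, hT⟩ := exists_top_subset U b t (by omega)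
  have hYc : (U \ T).card = U.card - t := by rw [Finset.card_sdiff_of_subset hTU, hTc]
  obtain ⟨Z, hZY, hZc, hZ⟩ := exists_top_subset (U \ T) b z (by omega)
  have hWc : ((U \ T) \ Z).card = U.card - t - z := by
    rw [Finset.card_sdiff_of_subset hZY, hZc, hYc]
  obtain ⟨v₀, hv₀, hv₀min⟩ := Finset.exists_min_image Z b (by rw [← Finset.card_pos]; omega)
  set β := b v₀ with hβ
  have hβ0 : 0 ≤ β := hb v₀ (Finset.sdiff_subset (hZY hv₀))
  have hjt : t * j ≤ U.card - t - z := by omega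
  have hjW : j ≤ U.card - t - z := le_trans (Nat.le_mul_of_pos_left j ht) hjt
  obtain ⟨i, hi, hiβ⟩ := hind (A \ AT) Finset.sdiff_subset ((U \ T) \ Z)
    (Finset.sdiff_subset.trans Finset.sdiff_subset)
    (by rw [Finset.card_sdiff_of_subset hATA]; omega) (by omega) β (fun v hv => hZ v₀ hv₀ v hv)
  have hD := light_stars_le U T hTU b j hj θ q E (by rw [← Finset.card_pos]; omega) hθ hb hT
    (by rw [hTc]; linarith)
    (by rw [hq, hYc, Nat.cast_sub (by omega)]) (by rw [hTc]; exact htq) (by omega) (by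
      rw [hYc, Finset.filter_congr fun S _ => (lt_sub_iff_add_lt' :
        ∑ v ∈ S, b v < θ ↔ a i₀ + ∑ v ∈ S, b v < 1)]
      exact hdeg i₀ hi₀)
  have hW := weight_lower_bound U T Z hTU hZY b j θ β hθ hb hv₀min (by omega)
    (by rw [hTc, hWc]; exact hjt)
  rw [hTc] at hD
  rw [hWc, hTc, hZc] at hW
  set D := ∑ u ∈ T, ((((U \ T).powersetCard j).filter fun R => b u + ∑ v ∈ R, b v < θ).card : ℝ)
  set M : ℝ := ((U.card - t - z).choose j : ℝ) with hM
  have hM0 : 0 < M := by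
    rw [hM]
    exact_mod_cast Nat.choose_pos hjW
  have hsplit : ∑ i ∈ A \ AT, a i + ∑ i ∈ AT, a i = ∑ i ∈ A, a i := Finset.sum_sdiff hATA
  have h1 : (t - z) * a i₀ ≤ ∑ i ∈ A \ AT, a i := by
    have := Finset.card_nsmul_le_sum (A \ AT) a (a i₀) fun i hi => hmin i (Finset.sdiff_subset hi)
    rw [Finset.card_sdiff_of_subset hATA, hA, hATc, nsmul_eq_mul, Nat.cast_sub hzt] at this
    exact this
  have h2 : z * max (a i₀) (1 - (j + 1) * β) ≤ ∑ i ∈ AT, a i := by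
    have := Finset.card_nsmul_le_sum AT a (max (a i₀) (1 - (j + 1) * β)) fun i' hi' =>
      max_le (hmin i' (hATA hi')) (by linarith [hAT i' hi' i hi])
    simpa [hATc] using this
  have h3 : θ ≤ (j + 1) * (max (a i₀) (1 - (j + 1) * β) - a i₀ + β) := by
    have e1 := le_max_left (a i₀) (1 - (j + 1) * β)
    have e2 := le_max_right (a i₀) (1 - (j + 1) * β)
    nlinarith [mul_nonneg (Nat.cast_nonneg (α := ℝ) j) (sub_nonneg.2 e1)]
  set μ := max (a i₀) (1 - (j + 1) * β)
  have h4 : z * (μ - a i₀ + β) * M < D * θ := by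
    have : ∑ v ∈ U, b v < t * θ - z * (μ - a i₀) := by
      rw [hθdef]
      linarith
    nlinarith [mul_lt_mul_of_pos_left this hM0]
  have h5 : z * M * θ < (j + 1) * D * θ := by
    have : z * M * θ ≤ z * M * ((j + 1) * (μ - a i₀ + β)) := by gcongr
    have : ((j : ℝ) + 1) * (z * (μ - a i₀ + β) * M) < (j + 1) * (D * θ) := by gcongr
    linarith
  have h6 : z * M < (j + 1) * D := lt_of_mul_lt_mul_right h5 hθ.le
  have h7 : z * M * (q - 2 * t) < (j + 1) * D * (q - 2 * t) :=
    mul_lt_mul_of_pos_right h6 (by linarith)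
  have h8 : ((j : ℝ) + 1) * ((q - 2 * t) * D) ≤ (j + 1) * ((q - t) * E) := by gcongr
  linarith

lemma choose_add_le (N k s n : ℕ) (hn : N + s ≤ n) :
    (N + s).choose (k + 1) ≤ N.choose (k + 1) + s * n ^ k := by
  induction s with
  | zero => simp
  | succ s ih =>
    have h1 := ih (by omega)
    have h2 : (N + s).choose k ≤ n ^ k :=
      (Nat.choose_le_pow _ _).trans (Nat.pow_le_pow_left (by omega) _)
    rw [← add_assoc, Nat.choose_succ_succ', add_mul, one_mul]
    omega

lemma card_filter_isLeft_s8 {α β : Type*} (e : Finset (α ⊕ β)) :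
    (e.filter fun v => v.isLeft = true).card = e.toLeft.card := by
  rw [← Finset.card_map (Function.Embedding.inl : α ↪ α ⊕ β) (s := e.toLeft)]
  congr 1
  ext (x | x) <;> simp

lemma card_filter_isRight_s8 {α β : Type*} (e : Finset (α ⊕ β)) :
    (e.filter fun v => v.isRight = true).card = e.toRight.card := by
  rw [← Finset.card_map (Function.Embedding.inr : β ↪ α ⊕ β) (s := e.toRight)]
  congr 1
  ext (x | x) <;> simp

/-- A deletion of the lightest `k`-set turns a fractional cover of weight less than `m` of a
balanced `(1,k)`-partite hypergraph, in which all vertices outside `A` have full degree, into a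
fractional cover of weight less than `|A|` of the edges meeting `A`. -/
lemma normalized_weight_lt {ι V : Type*} [Fintype ι] [DecidableEq ι] [Fintype V] [DecidableEq V]
    (k : ℕ) (hk : 0 < k) (hcard : Fintype.card V = k * Fintype.card ι) (A : Finset ι)
    (a : ι → ℝ) (b : V → ℝ) (S₀ : Finset V) (hS₀ : S₀.card = k)
    (hfull : ∀ i ∉ A, 1 ≤ a i + ∑ v ∈ S₀, b v)
    (hsum : ∑ i, a i + ∑ v, b v < Fintype.card ι) :
    ∑ i ∈ A, (a i + ∑ v ∈ S₀, b v) + ∑ v ∈ Finset.univ \ S₀, (b v - (∑ v ∈ S₀, b v) / k) <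
      A.card := by
  set σ := ∑ v ∈ S₀, b v with hσ
  have hk' : (k : ℝ) ≠ 0 := by exact_mod_cast hk.ne'
  have h1 : ∑ i ∈ Finset.univ \ A, a i + ∑ i ∈ A, a i = ∑ i, a i :=
    Finset.sum_sdiff (Finset.subset_univ A)
  have h2 : ((Fintype.card ι : ℝ) - A.card) * (1 - σ) ≤ ∑ i ∈ Finset.univ \ A, a i := by
    have := Finset.card_nsmul_le_sum (Finset.univ \ A) a (1 - σ) fun i hi => by
      linarith [hfull i (Finset.mem_sdiff.1 hi).2]
    rwa [Finset.card_sdiff_of_subset (Finset.subset_univ A), nsmul_eq_mul,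
      Nat.cast_sub (Finset.card_le_card (Finset.subset_univ A)), Finset.card_univ] at this
  have h3 : ∑ v ∈ Finset.univ \ S₀, b v + σ = ∑ v, b v :=
    Finset.sum_sdiff (Finset.subset_univ S₀)
  rw [Finset.sum_add_distrib, Finset.sum_sub_distrib, Finset.sum_const, Finset.sum_const,
    nsmul_eq_mul, nsmul_eq_mul, Finset.card_sdiff_of_subset (Finset.subset_univ S₀),
    Nat.cast_sub (Finset.card_le_card (Finset.subset_univ S₀)), Finset.card_univ, hcard, hS₀]
  have h4 : (((k * Fintype.card ι : ℕ) : ℝ) - k) * (σ / k) = (Fintype.card ι - 1) * σ := by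
    push_cast
    field_simp
  rw [h4]
  linarith

set_option maxHeartbeats 1000000 in
/-- The parameters for which `weight_not_lt` is applied satisfy its numerical hypotheses. -/
lemma exists_parameters (j : ℕ) (hj : 2 ≤ j) (ε : ℝ) (hε : 0 < ε)
    (hε₀ : ε < 1 / (3 * ((j + 1 : ℕ) : ℝ) ^ 2)) :
    ∃ c₀ : ℝ, 0 < c₀ ∧ ∃ n₀ : ℕ, ∀ c : ℝ, 0 < c → c < c₀ → ∀ n : ℕ, n₀ ≤ n → ∀ t : ℕ,
      (n : ℝ) / (3 * ((j + 1 : ℕ) : ℝ) ^ 2) ≤ t → (t : ℝ) ≤ (n : ℝ) / (2 * (j + 1 : ℕ)) →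
      ∃ (z : ℕ) (q E : ℝ), 0 < t ∧ 0 < z ∧ z ≤ t ∧ (z : ℝ) < ε * n ∧ j + 1 ≤ n ∧
        t * j + t + z + 1 ≤ n - (j + 1) ∧ q * j = ((n - (j + 1) : ℕ) : ℝ) - t ∧
        2 * (t : ℝ) < q ∧
        (j + 1) * ((q - t) * E) ≤ z * ((n - (j + 1) - t - z).choose j) * (q - 2 * t) ∧
        ((n - t + 1).choose (j + 1) : ℝ) + √c * (n : ℝ) ^ (j + 1) ≤
          ((n - (j + 1) - t).choose (j + 1) : ℝ) + E := by
  set κ : ℝ := 1 / (4 ^ j * (j.factorial : ℝ)) with hκ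
  have hκ0 : 0 < κ := by positivity
  set δ : ℝ := ε * κ / (16 * ((j : ℝ) + 1) ^ 2) with hδ
  have hδ0 : 0 < δ := by positivity
  obtain ⟨n₁, hn₁⟩ := exists_nat_ge (((j : ℝ) + 2) / δ)
  obtain ⟨n₂, hn₂⟩ := exists_nat_ge (4 / ε)
  refine ⟨δ ^ 2, by positivity, max (max n₁ n₂) (6 * (j + 1) ^ 3), ?_⟩
  intro c hc0 hc n hn t ht1 ht2
  have hnn₁ : (n₁ : ℝ) ≤ n := by exact_mod_cast (le_max_left _ _).trans ((le_max_left _ _).trans hn)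
  have hnn₂ : (n₂ : ℝ) ≤ n := by exact_mod_cast (le_max_right _ _).trans ((le_max_left _ _).trans hn)
  have hnn₃ : 6 * (j + 1) ^ 3 ≤ n := (le_max_right _ _).trans hn
  have hj' : (2 : ℝ) ≤ j := by exact_mod_cast hj
  have hsqrt : √c ≤ δ := by
    rw [Real.sqrt_le_left hδ0.le]
    exact hc.le
  push_cast at hε₀ ht1 ht2
  rw [lt_div_iff₀ (by positivity)] at hε₀
  rw [div_le_iff₀ (by positivity)] at ht1
  rw [le_div_iff₀ (by positivity)] at ht2
  rw [div_le_iff₀ hδ0] at hn₁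
  rw [div_le_iff₀ hε] at hn₂
  have hεn : 4 ≤ ε * n := by nlinarith
  have hnδ : (j : ℝ) + 2 ≤ n * δ := by nlinarith
  have hn3 : 6 * ((j : ℝ) + 1) ^ 3 ≤ n := by exact_mod_cast hnn₃
  have hn0 : (0 : ℝ) < n := lt_of_lt_of_le (by positivity) hn3
  have hn54 : 54 * ((j : ℝ) + 1) ≤ n := by nlinarith [sq_nonneg ((j : ℝ) + 1 - 3)]
  have htk : 2 * ((j : ℝ) + 1) ≤ t := by
    have : 2 * ((j : ℝ) + 1) * (3 * ((j : ℝ) + 1) ^ 2) ≤ t * (3 * ((j : ℝ) + 1) ^ 2) := by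
      linarith
    exact le_of_mul_le_mul_right this (by positivity)
  have hεt : ε * n ≤ t := by
    have : ε * n * (3 * ((j : ℝ) + 1) ^ 2) ≤ t * (3 * ((j : ℝ) + 1) ^ 2) := by nlinarith
    exact le_of_mul_le_mul_right this (by positivity)
  have ht6 : 6 * (t : ℝ) ≤ n := by nlinarith [Nat.cast_nonneg (α := ℝ) t]
  have hε27 : 27 * (ε * n) ≤ n := by
    have : ε * 27 ≤ 1 := by nlinarith [sq_nonneg ((j : ℝ) - 2)]
    nlinarith
  set z := ⌊ε * n / 2⌋₊ with hz
  have hz1 : (z : ℝ) ≤ ε * n / 2 := Nat.floor_le (by positivity)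
  have hz2 : ε * n / 2 < z + 1 := Nat.lt_floor_add_one _
  have hz3 : ε * n / 4 ≤ z := by linarith
  have hjn : j + 1 ≤ n := by
    have : ((j + 1 : ℕ) : ℝ) ≤ n := by push_cast; linarith
    exact_mod_cast this
  have hsize : t * j + t + z + 1 + (j + 1) ≤ n := by
    have : ((t * j + t + z + 1 + (j + 1) : ℕ) : ℝ) ≤ n := by push_cast; linarith
    exact_mod_cast this
  set q : ℝ := (((n - (j + 1) : ℕ) : ℝ) - t) / j with hq
  have hqj : q * j = ((n - (j + 1) : ℕ) : ℝ) - t := div_mul_cancel₀ _ (by positivity)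
  have hqj' : q * j = (n : ℝ) - (j + 1) - t := by
    rw [hqj, Nat.cast_sub hjn]
    push_cast
    ring
  have hqt : (t : ℝ) ≤ 2 * j * (q - 2 * t) := by linarith
  have hq2 : 0 < q - 2 * t := by
    by_contra hneg
    nlinarith
  have hpow : 0 < (n : ℝ) ^ j := by positivity
  have hM : κ * (n : ℝ) ^ j ≤ ((n - (j + 1) - t - z).choose j : ℝ) := by
    refine le_trans ?_ (Nat.pow_le_choose j (n - (j + 1) - t - z))
    have h1 : (n : ℝ) / 4 ≤ ((n - (j + 1) - t - z + 1 - j : ℕ) : ℝ) := by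
      have h2 : n ≤ (n - (j + 1) - t - z + 1 - j) + (j + 1 + t + z + j) := by omega
      have h3 : (n : ℝ) ≤ ((n - (j + 1) - t - z + 1 - j : ℕ) : ℝ) + (j + 1 + t + z + j) := by
        exact_mod_cast h2
      linarith
    calc κ * (n : ℝ) ^ j = ((n : ℝ) / 4) ^ j / j.factorial := by
          rw [hκ, div_pow]
          field_simp
      _ ≤ _ := by gcongr
  refine ⟨z, q, 2 * δ * (n : ℝ) ^ (j + 1), ?_, ?_, ?_, by linarith, hjn, by omega, hqj,
    by linarith, ?_, ?_⟩
  · have : (0 : ℝ) < t := by linarith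
    exact_mod_cast this
  · have : (0 : ℝ) < z := by linarith
    exact_mod_cast this
  · have : (z : ℝ) ≤ t := by linarith
    exact_mod_cast this
  · have h1 : ε * n / 4 * (κ * (n : ℝ) ^ j) ≤ z * ((n - (j + 1) - t - z).choose j : ℝ) := by
      gcongr
    have h2 : q - t ≤ (2 * j + 1) * (q - 2 * t) := by linarith
    have h3 : (q - t) * (2 * δ * (n : ℝ) ^ (j + 1)) ≤
        (2 * j + 1) * (q - 2 * t) * (2 * δ * (n : ℝ) ^ (j + 1)) := by gcongr
    have h4 : ε * n / 4 * (κ * (n : ℝ) ^ j) = 4 * ((j : ℝ) + 1) ^ 2 * δ * (n : ℝ) ^ (j + 1) := by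
      rw [hδ, pow_succ (n : ℝ) j]
      field_simp
      ring
    have hG : 0 ≤ (q - 2 * t) * (δ * (n : ℝ) ^ (j + 1)) := by positivity
    calc ((j : ℝ) + 1) * ((q - t) * (2 * δ * (n : ℝ) ^ (j + 1)))
        ≤ (j + 1) * ((2 * j + 1) * (q - 2 * t) * (2 * δ * (n : ℝ) ^ (j + 1))) := by gcongr
      _ ≤ 4 * ((j : ℝ) + 1) ^ 2 * δ * (n : ℝ) ^ (j + 1) * (q - 2 * t) := by
        linarith [mul_nonneg (by positivity : (0 : ℝ) ≤ 2 * ((j : ℝ) + 1)) hG]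
      _ = ε * n / 4 * (κ * (n : ℝ) ^ j) * (q - 2 * t) := by rw [h4]
      _ ≤ _ := by gcongr
  · have h1 := choose_add_le (n - (j + 1) - t) j (j + 2) n (by
      have : 0 < t := by
        have : (0 : ℝ) < t := by linarith
        exact_mod_cast this
      omega)
    rw [show n - (j + 1) - t + (j + 2) = n - t + 1 by omega] at h1
    have h2 : ((n - t + 1).choose (j + 1) : ℝ) ≤
        (n - (j + 1) - t).choose (j + 1) + (j + 2) * (n : ℝ) ^ j := by exact_mod_cast h1
    have h3 : ((j : ℝ) + 2) * (n : ℝ) ^ j ≤ n * δ * (n : ℝ) ^ j := by gcongr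
    have h4 : √c * (n : ℝ) ^ (j + 1) ≤ δ * (n : ℝ) ^ (j + 1) := by gcongr
    rw [pow_succ] at h4 ⊢
    linarith

/-- Lemma 5.3 of the paper: for `k ≥ 3` there is `ε₀ > 0` such that for `0 < ε < ε₀` there
are `c₀ > 0` and `n₀` such that for `0 < c < c₀`, `n ≥ n₀` with `k ∣ n`, and
`n/(3k²) ≤ t ≤ n/(2k)`: if `H` is a balanced `(1,k)`-partite `(k+1)`-graph with classes
`X = {x_1,…,x_{n/k}}`, `[n]`, with `d_H(x) ≥ C(n,k) - C(n-t+1,k) - √c·n^k` for `x ∈ X'`,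
`d_H(x) = C(n,k)` for `x ∈ X ∖ X'`, and every independent set `S` satisfies
`|S ∩ X| ≤ (t/n - ε)n` or `|S ∩ [n]| ≤ (1 - t/n - ε)n`, then `H` has a fractional perfect
matching. -/
theorem stmt_8 (k : ℕ) (hk : 3 ≤ k) :
    ∃ ε₀ : ℝ, 0 < ε₀ ∧ ∀ ε : ℝ, 0 < ε → ε < ε₀ →
    ∃ c₀ : ℝ, 0 < c₀ ∧ ∃ n₀ : ℕ, ∀ c : ℝ, 0 < c → c < c₀ →
    ∀ n : ℕ, n₀ ≤ n → k ∣ n → ∀ t : ℕ,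
      (n : ℝ) / (3 * k ^ 2) ≤ t → (t : ℝ) ≤ (n : ℝ) / (2 * k) →
      ∀ H : Finset (Finset (Fin (n / k) ⊕ Fin n)),
        (∀ e ∈ H, (e.filter fun v => v.isLeft = true).card = 1 ∧ e.card = k + 1) →
        (∀ i : Fin (n / k), (i : ℕ) < t →
          (Nat.choose n k : ℝ) - (Nat.choose (n - t + 1) k : ℝ) - Real.sqrt c * (n : ℝ) ^ k ≤
            ((H.filter fun e => Sum.inl i ∈ e).card : ℝ)) →
        (∀ i : Fin (n / k), t ≤ (i : ℕ) →
          (H.filter fun e => Sum.inl i ∈ e).card = Nat.choose n k) →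
        (∀ S : Finset (Fin (n / k) ⊕ Fin n), (∀ e ∈ H, ¬ e ⊆ S) →
          ((S.filter fun v => v.isLeft = true).card : ℝ) ≤ ((t : ℝ) / n - ε) * n ∨
          ((S.filter fun v => v.isRight = true).card : ℝ) ≤ (1 - (t : ℝ) / n - ε) * n) →
        ∃ h : Finset (Fin (n / k) ⊕ Fin n) → ℝ,
          (∀ e, 0 ≤ h e ∧ h e ≤ 1) ∧ (∀ e ∉ H, h e = 0) ∧
          (∀ v : Fin (n / k) ⊕ Fin n, ∑ e ∈ H.filter fun e => v ∈ e, h e ≤ 1) ∧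
          ∑ e ∈ H, h e = ((n / k + n : ℕ) : ℝ) / (k + 1) := by
  obtain ⟨j, rfl⟩ : ∃ j, k = j + 1 := ⟨k - 1, by omega⟩
  refine ⟨1 / (3 * ((j + 1 : ℕ) : ℝ) ^ 2), by positivity, fun ε hε hε₀ => ?_⟩
  obtain ⟨c₀, hc₀, n₀, hpar⟩ := exists_parameters j (by omega) ε hε hε₀
  refine ⟨c₀, hc₀, n₀, fun c hc hcc₀ n hn hdvd t ht1 ht2 => ?_⟩
  obtain ⟨z, q, E, ht0, hz0, hzt, hzε, hkn, hU, hq, htq, hnum, hE⟩ := hpar c hc hcc₀ n hn t ht1 ht2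
  have hmul : (j + 1) * (n / (j + 1)) = n := Nat.mul_div_cancel' hdvd
  generalize n / (j + 1) = m at hmul ⊢
  intro H hH hdeg hfull hind
  have hnm : n = (j + 1) * m := hmul.symm
  have hn0 : (0 : ℝ) < n := by exact_mod_cast (by omega : 0 < n)
  have hnmR : (n : ℝ) = (j + 1) * m := by exact_mod_cast hnm
  have htm : t ≤ m := by
    rw [le_div_iff₀ (by positivity)] at ht2
    have h1 : t * (2 * (j + 1)) ≤ n := by exact_mod_cast ht2
    nlinarith
  have hm0 : 0 < m := lt_of_lt_of_le ht0 htm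
  have htotal : ((m + n : ℕ) : ℝ) / ((j + 1 : ℕ) + 1) = m := by
    push_cast
    rw [hnmR]
    field_simp
    ring
  rw [htotal]
  by_contra hno
  obtain ⟨w, hw0, hwe, hwm⟩ := exists_fractional_cover_of_not_exists_fractional_matching H
    (fun e he => by rw [← Finset.card_pos, (hH e he).2]; omega) m (by exact_mod_cast hm0) hno
  rw [Fintype.sum_sum_type] at hwm
  set a : Fin m → ℝ := fun i => w (Sum.inl i)
  set b : Fin n → ℝ := fun v => w (Sum.inr v)
  -- every edge consists of a vertex of the first class and a `k`-subset of the second class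
  have hedge : ∀ e ∈ H, ∀ i, Sum.inl i ∈ e →
      e = Finset.disjSum {i} e.toRight ∧ e.toRight.card = j + 1 := by
    intro e he i hi
    obtain ⟨h1, h2⟩ := hH e he
    rw [card_filter_isLeft_s8] at h1
    have h3 : e.toLeft = {i} := by
      obtain ⟨i', hi'⟩ := Finset.card_eq_one.1 h1
      have : i ∈ e.toLeft := Finset.mem_toLeft.2 hi
      rw [hi', Finset.mem_singleton] at this
      rw [hi', this]
    refine ⟨?_, ?_⟩
    · conv_lhs => rw [← Finset.toLeft_disjSum_toRight (u := e), h3]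
    · have := Finset.card_toLeft_add_card_toRight (u := e)
      omega
  have hcover : ∀ i S, Finset.disjSum {i} S ∈ H → 1 ≤ a i + ∑ v ∈ S, b v := by
    intro i S h
    have := hwe _ h
    rwa [Finset.sum_disjSum, Finset.sum_singleton] at this
  let N : Fin m → Finset (Finset (Fin n)) := fun i =>
    (Finset.univ.powersetCard (j + 1)).filter fun S => Finset.disjSum {i} S ∈ H
  have hdegN : ∀ i, (H.filter fun e => Sum.inl i ∈ e).card ≤ (N i).card := by
    intro i
    refine Finset.card_le_card_of_injOn Finset.toRight (fun e he => ?_) (fun e he e' he' h => ?_)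
    · obtain ⟨heH, hie⟩ := Finset.mem_filter.1 he
      obtain ⟨h1, h2⟩ := hedge e heH i hie
      exact Finset.mem_filter.2 ⟨Finset.mem_powersetCard.2 ⟨Finset.subset_univ _, h2⟩, h1 ▸ heH⟩
    · obtain ⟨heH, hie⟩ := Finset.mem_filter.1 he
      obtain ⟨heH', hie'⟩ := Finset.mem_filter.1 he'
      rw [(hedge e heH i hie).1, (hedge e' heH' i hie').1, h]
  obtain ⟨S₀, -, hS₀c, hS₀⟩ := exists_top_subset (Finset.univ : Finset (Fin n)) (fun v => - b v)
    (j + 1) (by simpa using hkn)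
  replace hS₀ : ∀ u ∈ S₀, ∀ v ∉ S₀, b u ≤ b v := fun u hu v hv =>
    neg_le_neg_iff.1 (hS₀ u hu v (by simp [hv]))
  set σ := ∑ v ∈ S₀, b v with hσ
  let A : Finset (Fin m) := Finset.univ.filter fun i => (i : ℕ) < t
  have hAc : A.card = t := by
    rw [Fin.card_filter_val_lt]
    exact min_eq_right htm
  have hfullN : ∀ i ∉ A, 1 ≤ a i + σ := by
    intro i hi
    have hti : t ≤ (i : ℕ) := by simpa [A] using hi
    have h1 : N i = Finset.univ.powersetCard (j + 1) := by
      refine Finset.eq_of_subset_of_card_le (Finset.filter_subset _ _) ?_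
      rw [Finset.card_powersetCard, Finset.card_univ, Fintype.card_fin, ← hfull i hti]
      exact hdegN i
    have h2 : S₀ ∈ N i := by
      rw [h1]
      exact Finset.mem_powersetCard.2 ⟨Finset.subset_univ _, hS₀c⟩
    exact hcover i S₀ (Finset.mem_filter.1 h2).2
  have hweight := normalized_weight_lt (j + 1) (by omega) (by simpa using hnm) A a b S₀ hS₀c
    hfullN (by simpa using hwm)
  rw [← hσ, hAc] at hweight
  have hk0 : ((j + 1 : ℕ) : ℝ) ≠ 0 := by positivity
  have hshift : ∀ (i : Fin m) (S : Finset (Fin n)), S.card = j + 1 →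
      (a i + σ) + ∑ v ∈ S, (b v - σ / (j + 1 : ℕ)) = a i + ∑ v ∈ S, b v := by
    intro i S hS
    rw [Finset.sum_sub_distrib, Finset.sum_const, hS, nsmul_eq_mul, mul_div_cancel₀ _ hk0]
    ring
  have hUc : (Finset.univ \ S₀ : Finset (Fin n)).card = n - (j + 1) := by
    rw [Finset.card_sdiff_of_subset (Finset.subset_univ _), Finset.card_univ, Fintype.card_fin,
      hS₀c]
  refine absurd hweight (not_lt.2 (weight_not_lt A _ (Finset.univ \ S₀) _ j t z q E (by omega) ht0
    hz0 hzt hAc ?_ ?_ ?_ (by omega) (by rw [hUc]; exact hq) htq (by rw [hUc]; exact hnum)))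
  · intro v hv
    have h1 : σ ≤ (j + 1 : ℕ) * b v := by
      have := Finset.sum_le_card_nsmul S₀ b (b v) fun u hu => hS₀ u hu v (Finset.mem_sdiff.1 hv).2
      rwa [hS₀c, nsmul_eq_mul] at this
    rw [sub_nonneg, div_le_iff₀' (by positivity)]
    exact h1
  · intro i hi
    have hit : (i : ℕ) < t := by simpa [A] using hi
    rw [hUc]
    refine le_trans ?_ hE
    have h1 : (((Finset.univ \ S₀).powersetCard (j + 1)).filter fun S =>
        (a i + σ) + ∑ v ∈ S, (b v - σ / (j + 1 : ℕ)) < 1).card + (N i).card ≤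
        n.choose (j + 1) := by
      rw [← Finset.card_union_of_disjoint]
      · have : n.choose (j + 1) =
            ((Finset.univ : Finset (Fin n)).powersetCard (j + 1)).card := by simp
        rw [this]
        refine Finset.card_le_card (Finset.union_subset ?_ (Finset.filter_subset _ _))
        exact (Finset.filter_subset _ _).trans (Finset.powersetCard_mono Finset.sdiff_subset)
      · rw [Finset.disjoint_left]
        intro S hS hSN
        obtain ⟨hS1, hS2⟩ := Finset.mem_filter.1 hS
        rw [hshift i S (Finset.mem_powersetCard.1 hS1).2] at hS2
        linarith [hcover i S (Finset.mem_filter.1 hSN).2]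
    have h2 : ((((Finset.univ \ S₀).powersetCard (j + 1)).filter fun S =>
        (a i + σ) + ∑ v ∈ S, (b v - σ / (j + 1 : ℕ)) < 1).card : ℝ) + (N i).card ≤
        n.choose (j + 1) := by exact_mod_cast h1
    have h3 : ((H.filter fun e => Sum.inl i ∈ e).card : ℝ) ≤ (N i).card := by
      exact_mod_cast hdegN i
    linarith [hdeg i hit]
  · intro A' hA' W hW hA'c hWc β hβ
    have hWne : W.Nonempty := by
      rw [← Finset.card_pos]
      omega
    obtain ⟨v₁, hv₁⟩ := hWne
    have hβ' : ∀ v ∈ W ∪ S₀, b v - σ / (j + 1 : ℕ) ≤ β := by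
      intro v hv
      rcases Finset.mem_union.1 hv with hv | hv
      · exact hβ v hv
      · linarith [hβ v₁ hv₁, hS₀ v hv v₁ (Finset.mem_sdiff.1 (hW hv₁)).2]
    have hWS : (W ∪ S₀).card = W.card + (j + 1) := by
      rw [Finset.card_union_of_disjoint, hS₀c]
      exact Finset.disjoint_of_subset_left hW Finset.sdiff_disjoint
    have hex : ∃ e ∈ H, e ⊆ A'.disjSum (W ∪ S₀) := by
      by_contra! hcon
      have h1 : (A'.card : ℝ) + z = t := by exact_mod_cast hA'c
      have h2 : ((W ∪ S₀).card : ℝ) + t + z = n := by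
        exact_mod_cast (by omega : (W ∪ S₀).card + t + z = n)
      have h3 := hind (A'.disjSum (W ∪ S₀)) hcon
      rw [card_filter_isLeft_s8, card_filter_isRight_s8, Finset.toLeft_disjSum, Finset.toRight_disjSum,
        sub_mul, sub_mul, sub_mul, div_mul_cancel₀ _ hn0.ne', one_mul] at h3
      rcases h3 with h3 | h3 <;> linarith
    obtain ⟨e, he, hsub⟩ := hex
    obtain ⟨hl, hr⟩ := Finset.subset_disjSum.1 hsub
    obtain ⟨i, hi⟩ : e.toLeft.Nonempty := by
      rw [← Finset.card_pos, ← card_filter_isLeft_s8, (hH e he).1]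
      exact one_pos
    obtain ⟨h1, h2⟩ := hedge e he i (Finset.mem_toLeft.1 hi)
    refine ⟨i, hl hi, ?_⟩
    have h3 := hcover i e.toRight (h1 ▸ he)
    rw [← hshift i _ h2] at h3
    have h4 := Finset.sum_le_card_nsmul e.toRight (fun v => b v - σ / (j + 1 : ℕ)) β
      fun v hv => hβ' v (hr hv)
    rw [h2, nsmul_eq_mul] at h4
    push_cast at h3 h4 ⊢
    linarith
end
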